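/- arXiv:2006.11660 — 4 statements merged into one kernel-verified Lean document; each statement's English description precedes it below -/
import Mathlib

section
/- If G is a finite non-abelian group, then there exists an irreducible complex character χ of G and an element g of G such that χ(g) = 0. -/
open CategoryTheory

/-- An element `g` of a group is a *vanishing element* if some irreducible complex
character vanishes at `g`. -/
def IsVanishing {G : Type} [Group G] (g : G) : Prop :=
  ∃ V : FDRep ℂ G, Simple V ∧ V.character g = 0

open Polynomial in
lemma trace_diag {V : Type*} [AddCommGroup V] [Module ℂ V] [FiniteDimensional ℂ V]
    (f : Module.End ℂ V) (N : ℕ) (hN : N ≠ 0) (hf : f ^ N = 1) :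
    ∃ (n : ℕ) (μ : Fin n → ℂ), (∀ i, μ i ^ N = 1) ∧
      ∀ m : ℕ, LinearMap.trace ℂ V (f ^ m) = ∑ i, μ i ^ m := by
  classical
  have hss : f.IsSemisimple := by
    apply Module.End.isSemisimple_of_squarefree_aeval_eq_zero (p := X ^ N - 1)
    · have : (X ^ N - 1 : ℂ[X]).Separable := by
        have := (X_pow_sub_one_separable_iff (F := ℂ) (n := N)).2 (by exact_mod_cast hN)
        exact this
      exact this.squarefree
    · simp [hf]
  have hint : DirectSum.IsInternal f.eigenspace :=
    (DirectSum.isInternal_submodule_iff_iSupIndep_and_iSup_eq_top _).2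
      ⟨f.eigenspaces_iSupIndep, hss.iSup_eigenspace_eq_top⟩
  let b := hint.collectedBasis (fun μ => Module.finBasis ℂ (f.eigenspace μ))
  have : Finite (Σ μ : ℂ, Fin (Module.finrank ℂ (f.eigenspace μ))) := Module.Finite.finite_basis b
  obtain ⟨n, ⟨e⟩⟩ := Finite.exists_equiv_fin (Σ μ : ℂ, Fin (Module.finrank ℂ (f.eigenspace μ)))
  let c := b.reindex e
  let μ : Fin n → ℂ := fun i => (e.symm i).1
  have hc : ∀ i, f (c i) = μ i • c i := by
    intro i
    have h1 : b (e.symm i) ∈ f.eigenspace (e.symm i).1 :=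
      hint.collectedBasis_mem _ _
    have := Module.End.mem_eigenspace_iff.1 h1
    simpa [c, μ] using this
  have hcm : ∀ m : ℕ, ∀ i, (f ^ m) (c i) = μ i ^ m • c i := by
    intro m i
    induction m with
    | zero => simp
    | succ k ih => rw [pow_succ', Module.End.mul_apply, ih, map_smul, hc, smul_smul, pow_succ]
  refine ⟨n, μ, fun i => ?_, fun m => ?_⟩
  · have h1 := hcm N i
    rw [hf] at h1
    have h2 : (μ i ^ N - 1) • c i = 0 := by
      rw [sub_smul, ← h1]; simp
    rcases smul_eq_zero.1 h2 with h | h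
    · exact sub_eq_zero.1 h
    · exact absurd h (c.ne_zero i)
  · rw [LinearMap.trace_eq_matrix_trace ℂ c, Matrix.trace]
    refine Finset.sum_congr rfl fun i _ => ?_
    simp [Matrix.diag, LinearMap.toMatrix_apply, hcm]

open Polynomial in
lemma one_le_norm_of_const (N : ℕ) [NeZero N] (K : Type) [Field K] [Algebra ℚ K] [FiniteDimensional ℚ K]
    [IsCyclotomicExtension {N} ℚ K] (ζ : ℂ) (hζ : IsPrimitiveRoot ζ N) (F : ℤ[X]) (P : ℂ)
    (hP : P ≠ 0) (h : ∀ m : ℕ, m.Coprime N → aeval (ζ ^ m) F = P) : 1 ≤ ‖P‖ := by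
  let z : K := IsCyclotomicExtension.zeta N ℚ K
  have hz : IsPrimitiveRoot z N := IsCyclotomicExtension.zeta_spec N ℚ K
  let x : K := aeval z F
  have hxi : IsIntegral ℤ x := by
    have : IsIntegral ℤ z := hz.isIntegral (NeZero.pos N)
    exact (IsIntegral.of_mem_of_fg (Algebra.adjoin ℤ {z}) this.fg_adjoin_singleton _
      (aeval_mem_adjoin_singleton ℤ z))
  have hσ : ∀ σ : K →ₐ[ℚ] ℂ, σ x = P := by
    intro σ
    have h1 : IsPrimitiveRoot (σ z) N := hz.map_of_injective σ.injective
    obtain ⟨m, _, hm, hm2⟩ := hζ.isPrimitiveRoot_iff.1 h1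
    rw [← h m hm, hm2]
    exact (aeval_algHom_apply (σ.restrictScalars ℤ) z F).symm
  have hn := Algebra.norm_eq_prod_embeddings ℚ ℂ x
  simp only [hσ, Finset.prod_const] at hn
  obtain ⟨a, ha⟩ := IsIntegrallyClosed.isIntegral_iff.1 (Algebra.isIntegral_norm ℚ hxi)
  rw [← ha] at hn
  have hn' : (a : ℂ) = P ^ (Finset.univ : Finset (K →ₐ[ℚ] ℂ)).card := by simpa using hn
  have ha0 : a ≠ 0 := by
    rintro rfl
    exact pow_ne_zero _ hP (by simpa using hn'.symm)
  have hcard : (Finset.univ : Finset (K →ₐ[ℚ] ℂ)).card ≠ 0 := by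
    rw [Finset.card_univ, AlgHom.card]
    exact Module.finrank_pos.ne'
  have : (1 : ℝ) ≤ ‖P‖ ^ (Finset.univ : Finset (K →ₐ[ℚ] ℂ)).card := by
    rw [← norm_pow, ← hn', Complex.norm_intCast]
    exact_mod_cast Int.one_le_abs ha0
  exact (one_le_pow_iff_of_nonneg (norm_nonneg _) hcard).1 this

lemma simple_comm (G : Type) [Group G] [Fintype G]
    (hcon : ∀ V : FDRep ℂ G, Simple V → Module.finrank ℂ V ≤ 1)
    (M : Type) [AddCommGroup M] [Module (MonoidAlgebra ℂ G) M] [Module ℂ M]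
    [IsScalarTower ℂ (MonoidAlgebra ℂ G) M] [hM : IsSimpleModule (MonoidAlgebra ℂ G) M]
    (a b : G) (y : M) :
    MonoidAlgebra.of ℂ G (a * b) • y = MonoidAlgebra.of ℂ G (b * a) • y := by
  have : NeZero (Nat.card G : ℂ) := ⟨by simp⟩
  let σ : Representation ℂ G M :=
    ((Algebra.lsmul ℂ ℂ M : MonoidAlgebra ℂ G →ₐ[ℂ] Module.End ℂ M) :
      MonoidAlgebra ℂ G →* Module.End ℂ M).comp (MonoidAlgebra.of ℂ G)
  have hσ : ∀ g y, σ g y = MonoidAlgebra.of ℂ G g • y := fun g y => rfl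
  have : Nontrivial M := IsSimpleModule.nontrivial (MonoidAlgebra ℂ G) M
  have : Representation.IsIrreducible σ := by
    refine { exists_pair_ne := ⟨⊥, ⊤, ?_⟩, eq_bot_or_eq_top := ?_ }
    · intro hbt
      have : (⊥ : Submodule ℂ M) = ⊤ := congrArg Subrepresentation.toSubmodule hbt
      exact bot_ne_top this
    · intro p
      let q : Submodule (MonoidAlgebra ℂ G) M :=
        { carrier := p.toSubmodule
          add_mem' := fun h1 h2 => p.toSubmodule.add_mem h1 h2
          zero_mem' := p.toSubmodule.zero_mem
          smul_mem' := by
            intro r v hv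
            induction r using MonoidAlgebra.induction_on with
            | of g => exact p.apply_mem_toSubmodule g hv
            | add f g hf hg => rw [add_smul]; exact p.toSubmodule.add_mem hf hg
            | smul c f hf => rw [smul_assoc]; exact p.toSubmodule.smul_mem c hf }
      have hq : (q : Set M) = p.toSubmodule := rfl
      rcases eq_bot_or_eq_top q with h | h
      · left
        apply Subrepresentation.toSubmodule_injective
        apply SetLike.coe_injective
        rw [← hq, h]; rfl
      · right
        apply Subrepresentation.toSubmodule_injective
        apply SetLike.coe_injective
        rw [← hq, h]; rfl
  have : FiniteDimensional ℂ (MonoidAlgebra ℂ G) := inferInstance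
  have : FiniteDimensional ℂ M := Module.Finite.trans (MonoidAlgebra ℂ G) _
  have hsim : Simple (FDRep.of σ) := by
    rw [FDRep.simple_iff_char_is_norm_one]
    have := invertibleOfNonzero (NeZero.ne (Nat.card G : ℂ))
    have h1 := Representation.char_orthonormal σ σ
    rw [if_pos ⟨Representation.Equiv.refl σ⟩, inv_mul_eq_one₀ (NeZero.ne _)] at h1
    exact h1.symm
  have h2 : Module.finrank ℂ M ≤ 1 := hcon _ hsim
  have h3 : σ (a * b) = σ (b * a) := by
    rw [map_mul, map_mul]
    obtain ⟨v, hv⟩ := finrank_le_one_iff.1 h2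
    ext w
    obtain ⟨c, rfl⟩ := hv w
    obtain ⟨ca, hca⟩ := hv (σ a v)
    obtain ⟨cb, hcb⟩ := hv (σ b v)
    simp only [Module.End.mul_apply, map_smul, ← hca, ← hcb, smul_smul]
    congr 1; ring
  rw [← hσ, ← hσ, h3]

lemma exists_irred (G : Type) [Group G] [Fintype G] (h : ¬ ∀ a b : G, a * b = b * a) :
    ∃ V : FDRep ℂ G, Simple V ∧ 1 < Module.finrank ℂ V := by
  by_contra hcon
  push Not at hcon
  apply h
  intro a b
  let x : MonoidAlgebra ℂ G := MonoidAlgebra.of ℂ G (a * b) - MonoidAlgebra.of ℂ G (b * a)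
  have : NeZero (Nat.card G : ℂ) := ⟨by simp⟩
  have key : ∀ N : Submodule (MonoidAlgebra ℂ G) (MonoidAlgebra ℂ G),
      IsSimpleModule (MonoidAlgebra ℂ G) N → ∀ y ∈ N, x * y = 0 := by
    intro N hN y hy
    have := congrArg Subtype.val (simple_comm G hcon N a b ⟨y, hy⟩)
    rw [sub_mul, sub_eq_zero]
    exact this
  have hx : ∀ y, x * y = 0 := by
    intro y
    have hy : y ∈ sSup {m : Submodule (MonoidAlgebra ℂ G) (MonoidAlgebra ℂ G) | IsSimpleModule (MonoidAlgebra ℂ G) m} := by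
      rw [IsSemisimpleModule.sSup_simples_eq_top]; trivial
    rw [sSup_eq_iSup'] at hy
    refine Submodule.iSup_induction _ (motive := fun y => x * y = 0) hy (fun N y hy => key N.1 N.2 y hy) (by simp) ?_
    intro u v hu hv
    rw [mul_add, hu, hv, add_zero]
  have h1 := hx 1
  rw [mul_one, sub_eq_zero] at h1
  exact MonoidAlgebra.of_injective h1

/-- Burnside: every finite non-abelian group has an irreducible character vanishing
at some element. -/
theorem stmt0 (G : Type) [Group G] [Fintype G] (h : ¬ ∀ a b : G, a * b = b * a) :
    ∃ (V : FDRep ℂ G) (g : G), Simple V ∧ V.character g = 0 := by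
  classical
  obtain ⟨V, hV, hdim⟩ := exists_irred G h
  by_contra hcon
  push Not at hcon
  have hne : ∀ g, V.character g ≠ 0 := fun g => hcon V g hV
  let N := Nat.card G
  have hN : N ≠ 0 := Nat.card_pos.ne'
  have : NeZero N := ⟨hN⟩
  have hpow : ∀ g : G, g ^ N = 1 := fun g => pow_card_eq_one'
  have hd : ∀ g : G, ∃ (n : ℕ) (μ : Fin n → ℂ), (∀ i, μ i ^ N = 1) ∧
      ∀ m : ℕ, V.character (g ^ m) = ∑ i, μ i ^ m := by
    intro g
    obtain ⟨n, μ, h1, h2⟩ := trace_diag (V.ρ g) N hN (by rw [← map_pow, hpow, map_one])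
    exact ⟨n, μ, h1, fun m => by rw [← h2, FDRep.character, map_pow]⟩
  have hconj : ∀ g, V.character g⁻¹ = star (V.character g) := by
    intro g
    obtain ⟨n, μ, h1, h2⟩ := hd g
    have e1 : g⁻¹ = g ^ (N - 1) := by
      rw [inv_eq_iff_mul_eq_one, ← pow_succ', Nat.sub_add_cancel (Nat.pos_of_ne_zero hN), hpow]
    have e2 := h2 1
    rw [pow_one] at e2
    rw [e1, h2, e2, star_sum]
    refine Finset.sum_congr rfl fun i _ => ?_
    have hn : ‖μ i‖ = 1 := Complex.norm_eq_one_of_pow_eq_one (h1 i) hN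
    have h0 : μ i ≠ 0 := by rw [← norm_ne_zero_iff, hn]; exact one_ne_zero
    apply mul_left_cancel₀ h0
    rw [← pow_succ', Nat.sub_add_cancel (Nat.pos_of_ne_zero hN), h1, pow_one, Complex.star_def,
      Complex.mul_conj, Complex.normSq_eq_norm_sq, hn]
    simp
  have hsum : ∑ g : G, ‖V.character g‖ ^ 2 = (N : ℝ) := by
    have h1 := (FDRep.simple_iff_char_is_norm_one V).1 hV
    have h2 : ((∑ g : G, ‖V.character g‖ ^ 2 : ℝ) : ℂ) = ((N : ℝ) : ℂ) := by
      push_cast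
      rw [← h1]
      refine Finset.sum_congr rfl fun g _ => ?_
      rw [hconj, Complex.star_def, Complex.mul_conj, Complex.normSq_eq_norm_sq]
      push_cast; rfl
    exact_mod_cast h2
  let ζ : ℂ := Complex.exp (2 * Real.pi * Complex.I / N)
  have hζ : IsPrimitiveRoot ζ N := Complex.isPrimitiveRoot_exp N hN
  have hpoly : ∀ g : G, ∃ f : Polynomial ℤ, ∀ m : ℕ,
      Polynomial.aeval (ζ ^ m) f = V.character (g ^ m) := by
    intro g
    obtain ⟨n, μ, h1, h2⟩ := hd g
    choose k hk using fun i => hζ.eq_pow_of_pow_eq_one (h1 i)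
    refine ⟨∑ i, Polynomial.X ^ k i, fun m => ?_⟩
    rw [h2, map_sum]
    refine Finset.sum_congr rfl fun i _ => ?_
    rw [map_pow, Polynomial.aeval_X, ← (hk i).2, ← pow_mul, ← pow_mul, mul_comm]
  choose f hf using hpoly
  let s : Finset G := Finset.univ.erase 1
  have : NeZero ((N : ℕ) : ℚ) := ⟨by exact_mod_cast hN⟩
  have hcyc : IsCyclotomicExtension {N} ℚ (CyclotomicField N ℚ) := by
    convert CyclotomicField.isCyclotomicExtension N ℚ
    · rfl
    · exact Subsingleton.elim _ _
  have := IsCyclotomicExtension.finiteDimensional {N} ℚ (CyclotomicField N ℚ)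
  have hP := one_le_norm_of_const N (CyclotomicField N ℚ) ζ hζ (∏ g ∈ s, f g)
    (∏ g ∈ s, V.character g) (Finset.prod_ne_zero_iff.2 fun g _ => hne g) (by
      intro m hm
      rw [map_prod]
      simp only [hf]
      refine Finset.prod_bijective (fun g : G => g ^ m) ?_ ?_ (fun _ _ => rfl)
      · exact (powCoprime (G := G) hm.symm).bijective
      · intro g
        simp only [s, Finset.mem_erase, Finset.mem_univ, and_true]
        rw [not_iff_not]
        constructor
        · rintro rfl; simp
        · intro hg
          apply (powCoprime (G := G) hm.symm).injective
          simpa using hg)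
  rw [norm_prod] at hP
  have hlog : (0 : ℝ) ≤ ∑ g ∈ s, (‖V.character g‖ ^ 2 - 1) := by
    calc (0 : ℝ) ≤ Real.log ((∏ g ∈ s, ‖V.character g‖) ^ 2) := Real.log_nonneg (one_le_pow₀ hP)
      _ = ∑ g ∈ s, Real.log (‖V.character g‖ ^ 2) := by
        rw [← Finset.prod_pow, Real.log_prod]
        intro g _
        exact pow_ne_zero _ (norm_ne_zero_iff.2 (hne g))
      _ ≤ _ := Finset.sum_le_sum fun g _ =>
        Real.log_le_sub_one_of_pos (pow_pos (norm_pos_iff.2 (hne g)) 2)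
  have hsplit := Finset.add_sum_erase Finset.univ (fun g : G => ‖V.character g‖ ^ 2 - 1)
    (Finset.mem_univ 1)
  rw [Finset.sum_sub_distrib (s := Finset.univ), hsum] at hsplit
  simp only [Finset.sum_const, Finset.card_univ, nsmul_eq_mul, mul_one, FDRep.char_one,
    Complex.norm_natCast, Fintype.card_eq_nat_card] at hsplit
  have hd2 : (2 : ℝ) ≤ Module.finrank ℂ V := by exact_mod_cast hdim
  change _ + ∑ g ∈ s, _ = (N : ℝ) - (N : ℝ) at hsplit
  nlinarith
end

section
/- Let G be a finite group and χ an irreducible complex character of G of p-defect zero for a prime p (i.e., p does not divide |G|/χ(1)). Then χ(g) = 0 for every element g ∈ G whose order is divisible by p. -/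
open CategoryTheory

lemma aux_trace_idem {R ι : Type*} [CommRing R] [IsLocalRing R] [Fintype ι] [DecidableEq ι]
    (P Q : Matrix ι ι R) (hP : P * P = P) (hQ : Q * Q = Q)
    (h : (IsLocalRing.residue R).mapMatrix P = (IsLocalRing.residue R).mapMatrix Q) :
    P.trace = Q.trace := by
  set U := P * Q + (1 - P) * (1 - Q) with hU
  have h1 : P * U = U * Q := by
    have e1 : P * U = P * P * Q + (P - P * P) * (1 - Q) := by rw [hU]; noncomm_ring
    have e2 : U * Q = P * (Q * Q) + (1 - P) * (Q - Q * Q) := by rw [hU]; noncomm_ring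
    rw [e1, e2, hP, hQ]; simp
  have hU1 : (IsLocalRing.residue R).mapMatrix U = 1 := by
    have hQ' : (IsLocalRing.residue R).mapMatrix Q * (IsLocalRing.residue R).mapMatrix Q
      = (IsLocalRing.residue R).mapMatrix Q := by rw [← map_mul, hQ]
    rw [hU, map_add, map_mul, map_mul, map_sub, map_sub, h, map_one]
    set q := (IsLocalRing.residue R).mapMatrix Q
    have : q * q + (1 - q) * (1 - q) = 1 + 2 * (q * q - q) := by noncomm_ring
    rw [this, hQ']; simp
  have hdet : IsUnit U.det := by
    have : IsLocalRing.residue R U.det = 1 := by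
      rw [RingHom.map_det, hU1, Matrix.det_one]
    by_contra hc
    have : IsLocalRing.residue R U.det = 0 := by
      rw [IsLocalRing.residue_eq_zero_iff]; exact hc
    simp_all
  have h2 : P = U * Q * U⁻¹ := by
    rw [← h1, mul_assoc, Matrix.mul_nonsing_inv _ hdet, mul_one]
  rw [h2, Matrix.trace_mul_comm, ← mul_assoc, Matrix.nonsing_inv_mul _ hdet, one_mul]

lemma aux_core {R ι : Type*} [CommRing R] [IsDomain R] [IsLocalRing R] [Fintype ι] [DecidableEq ι]
    (p n : ℕ) (hp : p.Prime) (hn : 0 < n) (hpn : p ∣ n)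
    (hpR : (p : R) ∈ IsLocalRing.maximalIdeal R)
    (ω : R) (hω : IsPrimitiveRoot ω n)
    (A B F : Matrix ι ι R) (hAB : A * B = 1) (hBA : B * A = 1) (hA : A ^ n = 1)
    (hF : ∑ i ∈ Finset.range n, A ^ i * F * B ^ i = 1) : A.trace = 0 := by
  -- the (scaled) projections onto eigenspaces
  set N : R → Matrix ι ι R := fun ν => ∑ i ∈ Finset.range n, (ν • A) ^ i with hN
  have hBN : ∀ ν : R, ν ^ n = 1 → B * N ν = ν • N ν := by
    intro ν hν
    have h1 : (ν • A) * N ν = N ν := by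
      have := mul_geom_sum (ν • A) n
      rw [smul_pow, hν, hA, one_smul, sub_self, sub_mul, one_mul, sub_eq_zero] at this
      exact this
    calc B * N ν = B * ((ν • A) * N ν) := by rw [h1]
      _ = ν • ((B * A) * N ν) := by simp [mul_assoc]
      _ = _ := by rw [hBA, one_mul]
  have hBiN : ∀ ν : R, ν ^ n = 1 → ∀ i : ℕ, B ^ i * N ν = ν ^ i • N ν := by
    intro ν hν i
    induction i with
    | zero => simp
    | succ i ih => rw [pow_succ, mul_assoc, hBN ν hν, mul_smul_comm, ih, smul_smul, pow_succ']
  have hNFN : ∀ ν : R, ν ^ n = 1 → N ν * F * N ν = N ν := by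
    intro ν hν
    calc N ν * F * N ν = ∑ i ∈ Finset.range n, A ^ i * F * (B ^ i * N ν) := by
          rw [hN]; simp only [Finset.sum_mul]
          refine Finset.sum_congr rfl fun i _ => ?_
          rw [hBiN ν hν, smul_pow]; simp
          rfl
      _ = (∑ i ∈ Finset.range n, A ^ i * F * B ^ i) * N ν := by
          simp only [Finset.sum_mul, mul_assoc]
      _ = N ν := by rw [hF, one_mul]
  have hidem : ∀ ν : R, ν ^ n = 1 → (N ν * F) * (N ν * F) = N ν * F := by
    intro ν hν
    rw [← mul_assoc, hNFN ν hν]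
  obtain ⟨m, rfl⟩ := hpn
  have hm : 0 < m := Nat.pos_of_mul_pos_left hn
  set ζ := ω ^ m with hζ
  have hζp : ζ ^ p = 1 := by rw [hζ, ← pow_mul, mul_comm, hω.pow_eq_one]
  have hζres : IsLocalRing.residue R ζ = 1 := by
    have : Fact p.Prime := ⟨hp⟩
    have : CharP (IsLocalRing.ResidueField R) p := by
      refine ringChar.of_eq (CharP.ringChar_of_prime_eq_zero hp ?_)
      rw [← map_natCast (IsLocalRing.residue R), IsLocalRing.residue_eq_zero_iff]
      exact hpR
    apply frobenius_inj (IsLocalRing.ResidueField R) p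
    simp only [frobenius_def, one_pow]
    rw [← map_pow, hζp, map_one]
  have hζ1 : ζ ≠ 1 := by
    intro h
    have h1 := (hω.pow_eq_one_iff_dvd m).1 h
    have h2 := Nat.le_of_dvd hm h1
    have h3 := hp.two_le
    nlinarith
  have htr : ∀ ν : R, ν ^ (p * m) = 1 → (N ν * F).trace = (N (ν * ζ) * F).trace := by
    intro ν hν
    refine aux_trace_idem _ _ (hidem _ hν) (hidem _ ?_) ?_
    · rw [mul_pow, hν, one_mul, pow_mul, hζp, one_pow]
    · rw [map_mul, map_mul]
      congr 1
      simp only [hN, map_sum, map_pow]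
      refine Finset.sum_congr rfl fun i _ => ?_
      congr 1
      ext a b
      simp [hζres]
  set t : ℕ → R := fun i => (A ^ i * F).trace with ht
  have hT : ∀ ν : R, (N ν * F).trace = ∑ i ∈ Finset.range (p * m), ν ^ i * t i := by
    intro ν
    rw [hN]
    simp [Finset.sum_mul, Matrix.trace_sum, smul_pow, ht]
  have hn1 : 1 < p * m := by nlinarith [hp.two_le]
  have hv : (fun i : Fin (p * m) => t i * (1 - ζ ^ (i : ℕ))) = 0 := by
    refine Matrix.eq_zero_of_forall_index_sum_pow_mul_eq_zero (f := fun j : Fin (p * m) => ω ^ (j : ℕ)) ?_ ?_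
    · intro a b hab
      exact Fin.ext (hω.pow_inj a.2 b.2 hab)
    · intro j
      have h1 := htr (ω ^ (j : ℕ)) (by rw [← pow_mul, mul_comm, pow_mul, hω.pow_eq_one, one_pow])
      rw [hT, hT, ← sub_eq_zero, ← Finset.sum_sub_distrib] at h1
      rw [← h1, ← Fin.sum_univ_eq_sum_range (fun i => (ω ^ (j : ℕ)) ^ i * t i - (ω ^ (j : ℕ) * ζ) ^ i * t i)]
      refine Finset.sum_congr rfl fun i _ => ?_
      rw [mul_pow]; ring
  have ht1 : t 1 = 0 := by
    have := congrFun hv ⟨1, hn1⟩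
    simp only [pow_one, Pi.zero_apply, mul_eq_zero] at this
    rcases this with h | h
    · exact h
    · exact absurd (sub_eq_zero.1 h).symm hζ1
  calc A.trace = (A * ∑ i ∈ Finset.range (p * m), A ^ i * F * B ^ i).trace := by rw [hF, mul_one]
    _ = ∑ i ∈ Finset.range (p * m), t 1 := by
      rw [Finset.mul_sum, Matrix.trace_sum]
      refine Finset.sum_congr rfl fun i _ => ?_
      have hc : Commute A B := by rw [Commute, SemiconjBy, hAB, hBA]
      have : B ^ i * A ^ (i + 1) = A := by
        rw [pow_succ, ← mul_assoc, ← hc.symm.mul_pow, hBA, one_pow, one_mul]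
      rw [← mul_assoc, Matrix.trace_mul_comm, ← mul_assoc, ← mul_assoc, mul_assoc (B ^ i), ← pow_succ', this, ht]
      simp
    _ = 0 := by simp [ht1]

lemma aux_val (p : ℕ) (hp : p.Prime) : ∃ R : ValuationSubring ℂ,
    ((p : ℕ) : R) ∈ IsLocalRing.maximalIdeal R := by
  set A := (Int.castRingHom ℂ).range
  have hI : Ideal.span {((p : ℕ) : A)} ≠ ⊤ := by
    rw [Ne, Ideal.span_singleton_eq_top, isUnit_iff_exists_inv]
    rintro ⟨⟨b, ⟨z, rfl⟩⟩, hb⟩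
    have h1 := congrArg (fun x : A => (x : ℂ)) hb
    have h2 : ((p : ℤ) * z : ℤ) = 1 := by
      have : (p : ℂ) * (z : ℂ) = 1 := by simpa using h1
      exact_mod_cast this
    have := Int.isUnit_iff.1 (IsUnit.of_mul_eq_one _ h2)
    have := hp.two_le
    omega
  obtain ⟨B, hB1, hB2⟩ := Ideal.image_subset_nonunits_valuationSubring _ hI
  refine ⟨B, ?_⟩
  have : ((p : ℕ) : ℂ) ∈ (B.nonunits : Set ℂ) :=
    hB2 ⟨_, Ideal.mem_span_singleton_self _, by simp⟩
  rw [← B.image_maximalIdeal] at this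
  obtain ⟨x, hx, hxp⟩ := this
  convert hx
  exact Subtype.ext (by rw [hxp]; simp)

lemma aux_lattice {G V : Type} [Group G] [Fintype G] [AddCommGroup V] [Module ℂ V]
    [FiniteDimensional ℂ V] (ρ : Representation ℂ G V) (R : ValuationSubring ℂ) :
    ∃ (n : ℕ) (b : Module.Basis (Fin n) ℂ V) (A : G → Matrix (Fin n) (Fin n) R),
      ∀ h, LinearMap.toMatrix b b (ρ h) = R.subtype.mapMatrix (A h) := by
  set b0 := Module.finBasis ℂ V
  set s : Set V := Set.range (fun x : G × Fin (Module.finrank ℂ V) => ρ x.1 (b0 x.2)) with hs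
  set M : Submodule R V := Submodule.span R s with hM
  have hfin : Module.Finite R M := Module.Finite.span_of_finite R (Set.finite_range _)
  have hflat : Module.Flat R M := by
    rw [Module.Flat.flat_iff_torsion_eq_bot_of_isBezout, eq_bot_iff]
    rintro x ⟨a, ha⟩
    have h1 : ((a : R) : ℂ) • (x : V) = 0 := congrArg Subtype.val ha
    rcases smul_eq_zero.1 h1 with h | h
    · exact absurd (Subtype.ext h) (nonZeroDivisors.ne_zero a.2)
    · exact Subtype.ext h
  have hfree : Module.Free R M := Module.free_of_flat_of_isLocalRing
  have hinv : ∀ h : G, ∀ v ∈ M, ρ h v ∈ M := by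
    intro h v hv
    induction hv using Submodule.span_induction with
    | mem x hx =>
      obtain ⟨⟨k, i⟩, rfl⟩ := hx
      exact Submodule.subset_span ⟨(h * k, i), by simp⟩
    | zero => simp
    | add x y _ _ hx hy => rw [map_add]; exact add_mem hx hy
    | smul a x _ hx =>
      have : ρ h (a • x) = a • ρ h x := (ρ h).map_smul (a : ℂ) x
      rw [this]; exact M.smul_mem a hx
  set bM := Module.finBasis R M
  have hli : LinearIndependent ℂ (fun i => (bM i : V)) := by
    rw [← LinearIndependent.iff_fractionRing R ℂ]
    exact bM.linearIndependent.map' M.subtype (Submodule.ker_subtype M)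
  have hsp : ⊤ ≤ Submodule.span ℂ (Set.range (fun i => (bM i : V))) := by
    rw [← b0.span_eq, Submodule.span_le]
    rintro _ ⟨i, rfl⟩
    have h1 : b0 i ∈ M := Submodule.subset_span ⟨(1, i), by simp⟩
    have h2 := bM.sum_repr ⟨b0 i, h1⟩
    have h3 := congrArg Subtype.val h2
    simp only [AddSubmonoidClass.coe_finsetSum, Submodule.coe_smul] at h3
    rw [SetLike.mem_coe, ← h3]
    refine Submodule.sum_mem _ fun j _ => ?_
    exact Submodule.smul_mem _ (_ : ℂ) (Submodule.subset_span ⟨j, rfl⟩)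
  set b := Module.Basis.mk hli hsp with hb
  refine ⟨_, b, fun h => Matrix.of fun i j => bM.repr ⟨ρ h (bM j), hinv h _ (bM j).2⟩ i, ?_⟩
  intro h
  ext i j
  rw [LinearMap.toMatrix_apply]
  have h2 := bM.sum_repr ⟨ρ h (bM j), hinv h _ (bM j).2⟩
  have h3 := congrArg Subtype.val h2
  simp only [AddSubmonoidClass.coe_finsetSum, Submodule.coe_smul] at h3
  have hbj : ∀ j, b j = bM j := fun j => by rw [hb, Module.Basis.mk_apply]
  have h4 : ρ h (b j) = ∑ i, ((bM.repr ⟨ρ h (bM j), hinv h _ (bM j).2⟩ i : R) : ℂ) • b i := by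
    simp only [hbj]
    exact h3.symm
  rw [h4, Module.Basis.repr_sum_self]
  rfl

lemma aux_schur {G : Type} [Group G] [Fintype G] (V : FDRep ℂ G) (hV : Simple V)
    (f : V →ₗ[ℂ] V) : ∃ c : ℂ, ∑ h : G, V.ρ h * f * V.ρ h⁻¹ = c • (1 : V →ₗ[ℂ] V) ∧
      c * Module.finrank ℂ V = Fintype.card G * LinearMap.trace ℂ V f := by
  set T : V →ₗ[ℂ] V := ∑ h : G, V.ρ h * f * V.ρ h⁻¹ with hT
  have hcomm : ∀ k : G, T * V.ρ k = V.ρ k * T := by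
    intro k
    rw [hT, Finset.sum_mul, Finset.mul_sum]
    refine Fintype.sum_equiv (Equiv.mulLeft k⁻¹) _ _ fun h => ?_
    simp only [Equiv.coe_mulLeft, mul_inv_rev, inv_inv, map_mul]
    have : V.ρ k * V.ρ k⁻¹ = 1 := by rw [← map_mul]; simp
    simp only [← mul_assoc, this, one_mul]
  obtain ⟨c, hc⟩ : ∃ c : ℂ, c • (1 : V →ₗ[ℂ] V) = T := by
    let φ : V ⟶ V := (FDRep.forget₂HomLinearEquiv V V)
      (Rep.ofHom ⟨T, fun k => hcomm k⟩)
    obtain ⟨c, hc⟩ := endomorphism_simple_eq_smul_id ℂ φ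
    refine ⟨c, ?_⟩
    have := congrArg (fun ψ : V ⟶ V => ψ.hom.hom.hom) hc
    exact this
  refine ⟨c, hc.symm, ?_⟩
  have h1 := congrArg (LinearMap.trace ℂ V) hc
  rw [map_smul, LinearMap.trace_one, smul_eq_mul] at h1
  rw [h1, hT, map_sum]
  have : ∀ h : G, LinearMap.trace ℂ V (V.ρ h * f * V.ρ h⁻¹) = LinearMap.trace ℂ V f := by
    intro h
    rw [LinearMap.trace_mul_comm, ← mul_assoc, ← map_mul]; simp
  simp [this]

lemma aux_all {G : Type} [Group G] [Fintype G] (V : FDRep ℂ G) (hV : Simple V)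
    (R : ValuationSubring ℂ) (hd : Module.finrank ℂ V ≠ 0) :
    ∃ (n : ℕ) (A : G →* Matrix (Fin n) (Fin n) R) (E : Matrix (Fin n) (Fin n) R) (c : R),
      (∀ h, V.character h = ((A h).trace : R)) ∧ ∑ h : G, A h * E * A h⁻¹ = c • 1 ∧
      c * (Module.finrank ℂ V : R) = (Fintype.card G : R) := by
  obtain ⟨n, b, A, hA⟩ := aux_lattice V.ρ R
  have hn : n = Module.finrank ℂ V := by simpa using (Module.finrank_eq_card_basis b).symm
  have hinj : Function.Injective (R.subtype.mapMatrix (m := Fin n)) := 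
    Matrix.map_injective Subtype.val_injective
  let A' : G →* Matrix (Fin n) (Fin n) R :=
    { toFun := A
      map_one' := hinj (by rw [← hA, map_one V.ρ, map_one R.subtype.mapMatrix, LinearMap.toMatrix_one])
      map_mul' := fun x y => hinj (by
        rw [← hA, map_mul V.ρ, map_mul R.subtype.mapMatrix, ← hA, ← hA, LinearMap.toMatrix_mul]) }
  let i0 : Fin n := ⟨0, by omega⟩
  set E : Matrix (Fin n) (Fin n) R := Matrix.single i0 i0 1 with hE
  obtain ⟨c, hc1, hc2⟩ := aux_schur V hV (Matrix.toLin b b (R.subtype.mapMatrix E))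
  have htr : LinearMap.trace ℂ V (Matrix.toLin b b (R.subtype.mapMatrix E)) = 1 := by
    rw [Matrix.trace_toLin_eq, hE, RingHom.mapMatrix_apply, Matrix.map_single,
      Matrix.trace_single_eq_same, map_one]
  rw [htr, mul_one] at hc2
  have h1 : R.subtype.mapMatrix (∑ h : G, A' h * E * A' h⁻¹) = c • 1 := by
    have := congrArg (LinearMap.toMatrix b b) hc1
    rw [map_sum, map_smul, LinearMap.toMatrix_one] at this
    rw [← this, map_sum]
    refine Finset.sum_congr rfl fun h _ => ?_
    rw [LinearMap.toMatrix_mul, LinearMap.toMatrix_mul, hA, hA, LinearMap.toMatrix_toLin,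
      map_mul, map_mul]
    rfl
  have hcR : (((∑ h : G, A' h * E * A' h⁻¹) i0 i0 : R) : ℂ) = c := by
    have := congrFun (congrFun h1 i0) i0
    rw [RingHom.mapMatrix_apply, Matrix.map_apply, Matrix.smul_apply, Matrix.one_apply_eq,
      smul_eq_mul, mul_one] at this
    exact this
  refine ⟨n, A', E, (∑ h : G, A' h * E * A' h⁻¹) i0 i0, ?_, ?_, ?_⟩
  · intro h
    rw [FDRep.character, LinearMap.trace_eq_matrix_trace ℂ b, hA]
    simp [A', Matrix.trace]
  · apply hinj
    rw [h1, ← hcR]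
    ext i j
    by_cases hij : i = j <;> simp [hij]
  · apply Subtype.val_injective
    push_cast [hcR]
    exact hc2

lemma aux_dvd {G : Type} [Group G] [Fintype G] (V : FDRep ℂ G) (hV : Simple V)
    (hd : Module.finrank ℂ V ≠ 0) : Module.finrank ℂ V ∣ Fintype.card G := by
  obtain ⟨d, a, hco, hd', ha'⟩ := Nat.exists_coprime (Module.finrank ℂ V) (Fintype.card G)
  set k := Nat.gcd (Module.finrank ℂ V) (Fintype.card G)
  by_cases h1 : d = 1
  · rw [hd', ha', h1]; simp
  exfalso
  obtain ⟨r, hr, hrd⟩ := Nat.exists_prime_and_dvd h1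
  obtain ⟨R, hR⟩ := aux_val r hr
  obtain ⟨n, A, E, c, -, -, hc⟩ := aux_all V hV R hd
  have hk : (k : R) ≠ 0 := by
    intro h
    have : k ≠ 0 := by rintro h; rw [h] at hd'; simp at hd'; exact hd (by simp [hd'])
    exact this (by exact_mod_cast congrArg Subtype.val h)
  rw [hd', ha'] at hc
  push_cast at hc
  rw [← mul_assoc] at hc
  have hc' := mul_right_cancel₀ hk hc
  obtain ⟨e, rfl⟩ := hrd
  have ham : (a : R) ∈ IsLocalRing.maximalIdeal R := by
    rw [← hc']; push_cast
    exact Ideal.mul_mem_left _ _ (Ideal.mul_mem_right _ _ hR)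
  have hcop : IsCoprime ((r : ℕ) : R) (a : R) := (Nat.Coprime.coprime_mul_right hco).cast
  obtain ⟨x, y, hxy⟩ := hcop
  have : (1 : R) ∈ IsLocalRing.maximalIdeal R := by
    rw [← hxy]
    exact Ideal.add_mem _ (Ideal.mul_mem_left _ _ hR) (Ideal.mul_mem_left _ _ ham)
  exact (Ideal.ne_top_iff_one _).1 (IsLocalRing.maximalIdeal.isMaximal R).ne_top this

lemma aux_transversal {G S : Type} [Group G] [Fintype G] [Ring S] (A : G →* S) (E : S) (g : G) :
    ∃ F : S, ∑ i ∈ Finset.range (orderOf g), A g ^ i * F * A g⁻¹ ^ i =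
      ∑ h : G, A h * E * A h⁻¹ := by
  classical
  have := Fintype.ofFinite (G ⧸ Subgroup.zpowers g)
  let q : G ⧸ Subgroup.zpowers g → G := Quotient.out
  refine ⟨∑ t : G ⧸ Subgroup.zpowers g, A (q t)⁻¹ * E * A (q t), ?_⟩
  let e : (G ⧸ Subgroup.zpowers g) × Fin (orderOf g) → G := fun x => g ^ (x.2 : ℕ) * (q x.1)⁻¹
  have he : Function.Bijective e := by
    constructor
    · rintro ⟨t, i⟩ ⟨t', i'⟩ h
      have h' : q t * (g ^ (i : ℕ))⁻¹ = q t' * (g ^ (i' : ℕ))⁻¹ := by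
        have := congrArg (·⁻¹) h
        simpa [e] using this
      have ht : t = t' := by
        have h2 := congrArg (fun x : G => (x : G ⧸ Subgroup.zpowers g)) h'
        have h3 : ∀ (t : G ⧸ Subgroup.zpowers g) (i : ℕ),
            ((q t * (g ^ i)⁻¹ : G) : G ⧸ Subgroup.zpowers g) = t := by
          intro t i
          rw [QuotientGroup.mk_mul_of_mem]
          · exact Quotient.out_eq t
          · exact inv_mem (pow_mem (Subgroup.mem_zpowers g) _)
        simpa [h3] using h2
      subst ht
      have := inv_injective (mul_left_cancel h')
      have := pow_injOn_Iio_orderOf i.2 i'.2 this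
      exact Prod.ext rfl (Fin.ext this)
    · intro h
      have h1 : (q (h⁻¹ : G))⁻¹ * h⁻¹ ∈ Subgroup.zpowers g := by
        rw [← QuotientGroup.eq]; exact Quotient.out_eq _
      have h2 := inv_mem h1
      rw [← mem_powers_iff_mem_zpowers, mem_powers_iff_mem_range_orderOf] at h2
      obtain ⟨i, hi, hi2⟩ := Finset.mem_image.1 h2
      refine ⟨((h⁻¹ : G), ⟨i, Finset.mem_range.1 hi⟩), ?_⟩
      simp only [e]
      rw [hi2]; simp
  rw [← he.sum_comp (fun h => A h * E * A h⁻¹), Fintype.sum_prod_type_right,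
    ← Fin.sum_univ_eq_sum_range (fun i => A g ^ i * _ * A g⁻¹ ^ i)]
  refine Finset.sum_congr rfl fun i _ => ?_
  rw [Finset.mul_sum, Finset.sum_mul]
  refine Finset.sum_congr rfl fun t _ => ?_
  simp only [e, mul_assoc, map_mul, map_pow, mul_inv_rev, inv_inv, ← inv_pow]

/-- Brauer: an irreducible character of `p`-defect zero vanishes at every element of
order divisible by `p`. -/
theorem stmt7 (G : Type) [Group G] [Fintype G] (p : ℕ) (hp : p.Prime)
    (V : FDRep ℂ G) (hV : Simple V)
    (hdefect : ¬ p ∣ Fintype.card G / Module.finrank ℂ V)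
    (g : G) (hg : p ∣ orderOf g) :
    V.character g = 0 := by
  have hd : Module.finrank ℂ V ≠ 0 := by
    intro h
    rw [h] at hdefect
    simp at hdefect
  obtain ⟨m, hm⟩ := aux_dvd V hV hd
  rw [hm, Nat.mul_div_cancel_left _ (Nat.pos_of_ne_zero hd)] at hdefect
  obtain ⟨R, hR⟩ := aux_val p hp
  obtain ⟨k, A, E, c, htr, hsum, hc⟩ := aux_all V hV R hd
  have hcm : c = (m : R) := by
    have h0 : ((Module.finrank ℂ V : ℕ) : R) ≠ 0 := by
      intro h
      exact hd (by exact_mod_cast congrArg Subtype.val h)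
    apply mul_right_cancel₀ h0
    rw [hc, hm]; push_cast; ring
  have hcu : IsUnit c := by
    by_contra hcn
    have hcop : IsCoprime ((p : ℕ) : R) (m : R) := ((Nat.Prime.coprime_iff_not_dvd hp).2 hdefect).cast
    obtain ⟨x, y, hxy⟩ := hcop
    have : (1 : R) ∈ IsLocalRing.maximalIdeal R := by
      rw [← hxy, ← hcm]
      exact Ideal.add_mem _ (Ideal.mul_mem_left _ _ hR) (Ideal.mul_mem_left _ _ hcn)
    exact (Ideal.ne_top_iff_one _).1 (IsLocalRing.maximalIdeal.isMaximal R).ne_top this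
  obtain ⟨u, hu⟩ := hcu.exists_right_inv
  obtain ⟨F, hF⟩ := aux_transversal A (u • E) g
  have hF1 : ∑ h : G, A h * (u • E) * A h⁻¹ = 1 := by
    simp only [mul_smul_comm, smul_mul_assoc]
    rw [← Finset.smul_sum, hsum, smul_smul, mul_comm, hu, one_smul]
  have hpos : 0 < orderOf g := orderOf_pos g
  have hprim := Complex.isPrimitiveRoot_exp (orderOf g) hpos.ne'
  set w := Complex.exp (2 * Real.pi * Complex.I / (orderOf g : ℕ)) with hw
  have hwR : w ∈ R := by
    have hint : IsIntegral R w := by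
      refine ⟨Polynomial.X ^ (orderOf g) - 1, Polynomial.monic_X_pow_sub_C 1 hpos.ne', ?_⟩
      simp [hprim.pow_eq_one]
    obtain ⟨y, hy⟩ := (IsIntegrallyClosed.isIntegral_iff (R := R) (K := ℂ)).1 hint
    rw [← hy]; exact y.2
  have hprim' : IsPrimitiveRoot (⟨w, hwR⟩ : R) (orderOf g) :=
    IsPrimitiveRoot.of_map_of_injective (f := R.subtype) hprim Subtype.val_injective
  rw [htr]
  have := aux_core p (orderOf g) hp hpos hg hR _ hprim' (A g) (A g⁻¹) F
    (by rw [← map_mul]; simp) (by rw [← map_mul]; simp)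
    (by rw [← map_pow, pow_orderOf_eq_one, map_one]) (hF.trans hF1)
  rw [this]; rfl
end

section
/- Let G be a finite group, N a normal subgroup of G, and p a prime. If N has an irreducible character of p-defect zero, then every element of N whose order is divisible by p is a vanishing element of G (i.e., some irreducible character of G vanishes at it). -/
open CategoryTheory

namespace DZ

/-- Elementary irreducibility. -/
def Irr {G V : Type} [Group G] [AddCommGroup V] [Module ℂ V] (ρ : G →* (V →ₗ[ℂ] V)) : Prop :=
  ∀ U : Submodule ℂ V, (∀ g, ∀ v ∈ U, ρ g v ∈ U) → U = ⊥ ∨ U = ⊤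

theorem irr_of_simple {G : Type} [Group G] (θ : FDRep ℂ G) (hθ : Simple θ) : Irr θ.ρ := by
  intro U hU
  by_cases hb : U = ⊥
  · exact Or.inl hb
  right
  let σ : Representation ℂ G U := 
    { toFun := fun g => (θ.ρ g).restrict (hU g)
      map_one' := by ext; simp
      map_mul' := fun x y => by ext; simp }
  let ι : FDRep.of σ ⟶ θ := ⟨FGModuleCat.ofHom U.subtype, fun g => by
    ext v
    rfl⟩
  have hm : Mono ι := by
    apply (forget (FDRep ℂ G)).mono_of_mono_map
    rw [mono_iff_injective]
    intro a b h
    exact Subtype.ext h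
  have hne : ι ≠ 0 := by
    intro h0
    apply hb
    rw [eq_bot_iff]
    intro v hv
    have : ι.hom.hom.hom ⟨v, hv⟩ = 0 := by rw [h0]; rfl
    exact this
  have hi : IsIso ι := (Simple.mono_isIso_iff_nonzero ι).2 hne
  rw [eq_top_iff]
  intro v _
  let e := FDRep.isoToLinearEquiv (asIso ι)
  have h1 : e (e.symm v) = v := e.apply_symm_apply v
  have h2 : ((e.symm v : U) : θ) = v := h1
  rw [← h2]
  exact (e.symm v : U).2

theorem nontrivial_of_simple {G : Type} [Group G] (θ : FDRep ℂ G) (hθ : Simple θ) :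
    Nontrivial θ := by
  by_contra h
  rw [not_nontrivial_iff_subsingleton] at h
  apply id_nonzero θ
  ext v
  exact Subsingleton.elim (α := θ) _ _

theorem simple_of_irr {G V : Type} [Group G] [AddCommGroup V] [Module ℂ V] [Module.Finite ℂ V]
    [Nontrivial V] (ρ : Representation ℂ G V) (h : Irr ρ) : Simple (FDRep.of ρ) := by
  refine ⟨fun {W} f _ => ⟨?_, ?_⟩⟩
  · intro hf h0
    let e := FDRep.isoToLinearEquiv (asIso f)
    obtain ⟨v, hv⟩ := exists_ne (0 : V)
    apply hv
    have h1 : e (e.symm v) = v := e.apply_symm_apply v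
    have h2 : f.hom.hom.hom (e.symm v) = v := h1
    rw [← h2, h0]; rfl
  · intro hf
    have hcomm : ∀ g w, f.hom.hom.hom (W.ρ g w) = ρ g (f.hom.hom.hom w) := by
      intro g w
      have := congrArg (fun t => t.hom.hom w) (f.comm g)
      exact this
    have hinj : Function.Injective f.hom.hom.hom := by
      let K := LinearMap.ker f.hom.hom.hom
      have hK : ∀ g, ∀ v ∈ K, W.ρ g v ∈ K := by
        intro g v hv
        have h1 : f.hom.hom.hom v = 0 := hv
        have h2 := hcomm g v
        rw [h1, map_zero] at h2
        exact h2
      let σ : Representation ℂ G K :=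
        { toFun := fun g => (W.ρ g).restrict (hK g)
          map_one' := by ext; simp
          map_mul' := fun x y => by ext; simp }
      let ι : FDRep.of σ ⟶ W := ⟨FGModuleCat.ofHom K.subtype, fun g => by
        ext v
        rfl⟩
      have h0 : ι = 0 := by
        rw [← cancel_mono f, Limits.zero_comp]
        ext v
        exact v.2
      rw [← LinearMap.ker_eq_bot, eq_bot_iff]
      intro v hv
      have : ι.hom.hom.hom ⟨v, hv⟩ = 0 := by rw [h0]; rfl
      exact this
    have hsurj : LinearMap.range f.hom.hom.hom = ⊤ := by
      refine (h (LinearMap.range f.hom.hom.hom) ?_).resolve_left ?_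
      · rintro g _ ⟨w, rfl⟩
        exact ⟨W.ρ g w, hcomm g w⟩
      · intro hb
        apply hf
        ext w
        rw [LinearMap.range_eq_bot] at hb
        exact congrArg (fun t => t w) hb
    let e : W.V ≃ₗ[ℂ] V := LinearEquiv.ofBijective f.hom.hom.hom ⟨hinj, LinearMap.range_eq_top.1 hsurj⟩
    have : IsIso f.hom := by
      refine ⟨FGModuleCat.ofHom e.symm.toLinearMap, ?_, ?_⟩
      · ext w
        exact e.symm_apply_apply w
      · ext w
        exact e.apply_symm_apply w
    exact Action.isIso_of_hom_isIso f

theorem trace_ker {V W : Type} [AddCommGroup V] [Module ℂ V] [Module.Finite ℂ V]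
    [AddCommGroup W] [Module ℂ W] [Module.Finite ℂ W] (φ : V →ₗ[ℂ] W) (hφ : Function.Surjective φ)
    (f : V →ₗ[ℂ] V) (k : W →ₗ[ℂ] W) (hk : ∀ v, φ (f v) = k (φ v))
    (f' : LinearMap.ker φ →ₗ[ℂ] LinearMap.ker φ) (hf' : ∀ v, (f' v : V) = f v) :
    LinearMap.trace ℂ V f = LinearMap.trace ℂ _ f' + LinearMap.trace ℂ W k := by
  obtain ⟨s, hs⟩ := LinearMap.exists_rightInverse_of_surjective φ (LinearMap.range_eq_top.2 hφ)
  have hs' : ∀ w, φ (s w) = w := fun w => congrArg (fun t => t w) hs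
  let π : V →ₗ[ℂ] LinearMap.ker φ := LinearMap.codRestrict _ (LinearMap.id - s ∘ₗ φ) (by
    intro v; simp [hs'])
  have h1 : f = f ∘ₗ ((LinearMap.ker φ).subtype ∘ₗ π) + (f ∘ₗ s) ∘ₗ φ := by
    ext v; simp [π]
  rw [h1, map_add, ← LinearMap.comp_assoc, LinearMap.trace_comp_comm', LinearMap.trace_comp_comm' φ]
  congr 2
  · ext v
    simp [π, hf', hk]
  · ext w
    simp [hk, hs']

theorem trace_zero_of_maps {N : Type} [Group N] {W : Type} [AddCommGroup W] [Module ℂ W]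
    [Module.Finite ℂ W] {ι : Type} (σ : ι → (N →* (W →ₗ[ℂ] W))) (hσ : ∀ i, Irr (σ i)) (g : N)
    (h0 : ∀ i, LinearMap.trace ℂ W (σ i g) = 0) (s : Finset ι) :
    ∀ (V : Type) [AddCommGroup V] [Module ℂ V] [Module.Finite ℂ V] (ρ : N →* (V →ₗ[ℂ] V))
      (φ : ι → (V →ₗ[ℂ] W)) (_ : ∀ i n v, φ i (ρ n v) = σ i n (φ i v))
      (_ : ∀ v, (∀ i ∈ s, φ i v = 0) → v = 0), LinearMap.trace ℂ V (ρ g) = 0 := by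
  classical
  induction s using Finset.induction_on with
  | empty =>
    intro V _ _ _ ρ φ _ hz
    have : ρ g = 0 := by ext v; exact hz _ (by simp)
    rw [this, map_zero]
  | insert a s ha ih =>
    intro V _ _ _ ρ φ hφ hz
    have hr : LinearMap.range (φ a) = ⊥ ∨ LinearMap.range (φ a) = ⊤ := by
      apply hσ a
      rintro n _ ⟨v, rfl⟩
      exact ⟨ρ n v, hφ a n v⟩
    rcases hr with hr | hr
    · apply ih V ρ φ hφ
      intro v hv
      apply hz v
      intro i hi
      rcases Finset.mem_insert.1 hi with rfl | hi
      · rw [LinearMap.range_eq_bot] at hr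
        rw [hr]; rfl
      · exact hv i hi
    · have hinv : ∀ n, ∀ v ∈ LinearMap.ker (φ a), ρ n v ∈ LinearMap.ker (φ a) := by
        intro n v hv
        rw [LinearMap.mem_ker] at *
        rw [hφ, hv, map_zero]
      let ρ' : N →* (LinearMap.ker (φ a) →ₗ[ℂ] LinearMap.ker (φ a)) :=
        { toFun := fun g => (ρ g).restrict (hinv g)
          map_one' := by ext; simp
          map_mul' := fun x y => by ext; simp }
      rw [trace_ker (φ a) (LinearMap.range_eq_top.1 hr) (ρ g) (σ a g) (hφ a g) (ρ' g)
        (fun v => rfl), h0, add_zero]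
      apply ih _ ρ' (fun i => φ i ∘ₗ (LinearMap.ker (φ a)).subtype)
      · intro i n v
        exact hφ i n v
      · intro v hv
        apply Subtype.ext
        apply hz
        intro i hi
        rcases Finset.mem_insert.1 hi with rfl | hi
        · exact v.2
        · exact hv i hi

theorem clifford {G : Type} [Group G] [Fintype G] (N : Subgroup G) [N.Normal] {W : Type}
    [AddCommGroup W] [Module ℂ W] [Module.Finite ℂ W] [Nontrivial W]
    (σ : N →* (W →ₗ[ℂ] W)) (hσ : Irr σ) (g : N)
    (h0 : ∀ x : G, LinearMap.trace ℂ W (σ (MulAut.conjNormal x g)) = 0) :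
    ∃ V : FDRep ℂ G, Simple V ∧ V.character (g : G) = 0 := by
  classical
  let S : Set (Submodule ℂ (G → W)) := {U | U ≠ ⊥ ∧
    (∀ h : G, ∀ f ∈ U, (fun x => f (x * h)) ∈ U) ∧ ∀ f ∈ U, ∀ (n : N) x, f (n * x) = σ n (f x)}
  have hS : S.Nonempty := by
    refine ⟨{ carrier := {f | ∀ (n : N) x, f (n * x) = σ n (f x)}
              add_mem' := ?_
              zero_mem' := ?_
              smul_mem' := ?_ }, ?_, ?_, ?_⟩
    · intro a b ha hb n x
      simp [ha n x, hb n x]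
    · intro n x; simp
    · intro c a ha n x
      simp [ha n x]
    · obtain ⟨w, hw⟩ := exists_ne (0 : W)
      intro hb
      let f : G → W := fun x => if hx : x ∈ N then σ ⟨x, hx⟩ w else 0
      have hf : ∀ (n : N) x, f (n * x) = σ n (f x) := by
        intro n x
        by_cases hx : x ∈ N
        · have : (n : G) * x ∈ N := N.mul_mem n.2 hx
          simp only [f, hx, this, dif_pos]
          rw [← Module.End.mul_apply, ← map_mul]
          rfl
        · have : ¬ (n : G) * x ∈ N := by rwa [N.mul_mem_cancel_left n.2]
          simp [f, hx, this]
      have hf0 : f = 0 := by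
        rw [← Submodule.mem_bot ℂ, ← hb]
        exact hf
      have : f 1 = 0 := by rw [hf0]; rfl
      apply hw
      have h1 : (⟨1, N.one_mem⟩ : N) = 1 := rfl
      simpa [f, N.one_mem, h1] using this
    · intro h f hf n x
      have := hf n (x * h)
      rw [← mul_assoc] at this
      exact this
    · intro f hf
      exact hf
  obtain ⟨U, hU, hmin⟩ := (wellFounded_lt (α := Submodule ℂ (G → W))).has_min S hS
  obtain ⟨hU0, hUinv, hUeq⟩ := hU
  let ρ : Representation ℂ G U :=
    { toFun := fun h => (LinearMap.funLeft ℂ W (fun x => x * h)).restrict (fun f hf => hUinv h f hf)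
      map_one' := by
        ext f x
        simp [LinearMap.funLeft_apply]
      map_mul' := fun a b => by
        ext f x
        exact congrArg (f : G → W) (mul_assoc x a b).symm }
  have hρ : ∀ h (f : U) x, (ρ h f : G → W) x = (f : G → W) (x * h) := fun h f x => rfl
  have : Nontrivial U := Submodule.nontrivial_iff_ne_bot.2 hU0
  refine ⟨FDRep.of ρ, simple_of_irr ρ ?_, ?_⟩
  · intro T hT
    by_cases hb : T = ⊥
    · exact Or.inl hb
    right
    by_contra htop
    refine hmin (T.map U.subtype) ⟨?_, ?_, ?_⟩ ?_
    · intro h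
      apply hb
      exact Submodule.map_injective_of_injective U.subtype_injective (h.trans (Submodule.map_bot _).symm)
    · rintro h _ ⟨f, hf, rfl⟩
      exact ⟨ρ h f, hT h f hf, rfl⟩
    · rintro _ ⟨f, hf, rfl⟩
      exact hUeq f f.2
    · refine lt_of_le_of_ne (Submodule.map_subtype_le U T) ?_
      intro h
      apply htop
      rw [eq_top_iff]
      intro f _
      have : (f : G → W) ∈ T.map U.subtype := by rw [h]; exact f.2
      obtain ⟨f', hf', h'⟩ := this
      have : f' = f := Subtype.ext h'
      rwa [← this]
  · change LinearMap.trace ℂ U (ρ g) = 0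
    let τ : G → (N →* (W →ₗ[ℂ] W)) := fun x => σ.comp (MulAut.conjNormal x).toMonoidHom
    refine trace_zero_of_maps τ ?_ g ?_ Finset.univ U (ρ.comp N.subtype)
      (fun x => LinearMap.proj x ∘ₗ U.subtype) ?_ ?_
    · intro x T hT
      apply hσ
      intro n v hv
      have := hT ((MulAut.conjNormal x).symm n) v hv
      simpa [τ] using this
    · exact h0
    · intro x n f
      have := hUeq f f.2 (MulAut.conjNormal x n) x
      simp only [MulAut.conjNormal_apply, inv_mul_cancel_right] at this
      exact this
    · intro f hf
      apply Subtype.ext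
      funext x
      exact hf x (Finset.mem_univ x)


theorem char_integral {N : Type} [Group N] [Fintype N] {W : Type} [AddCommGroup W] [Module ℂ W]
    [Module.Finite ℂ W] (σ : N →* (W →ₗ[ℂ] W)) (x : N) :
    IsIntegral ℤ (LinearMap.trace ℂ W (σ x)) := by
  classical
  let b := Module.finBasis ℂ W
  rw [LinearMap.trace_eq_matrix_trace ℂ b, Matrix.trace_eq_sum_roots_charpoly,
    LinearMap.charpoly_toMatrix]
  have hroot : ∀ μ ∈ (σ x).charpoly.roots, IsIntegral ℤ μ := by
    intro μ hμ
    have h1 := Polynomial.isRoot_of_mem_roots hμ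
    rw [← Module.End.hasEigenvalue_iff_isRoot_charpoly] at h1
    obtain ⟨v, hv⟩ := h1.exists_hasEigenvector
    have h2 : ∀ k : ℕ, (σ x ^ k) v = μ ^ k • v := by
      intro k
      exact hv.pow_apply k
    have h3 := h2 (orderOf x)
    rw [← map_pow, pow_orderOf_eq_one, map_one, Module.End.one_apply] at h3
    have h4 : μ ^ orderOf x = 1 := by
      have : (μ ^ orderOf x - 1) • v = 0 := by rw [sub_smul, one_smul, ← h3, sub_self]
      exact sub_eq_zero.1 ((smul_eq_zero.1 this).resolve_right hv.2)
    apply IsIntegral.of_pow (orderOf_pos x)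
    rw [h4]; exact isIntegral_one
  exact IsIntegral.multiset_sum hroot

theorem char_conv {N : Type} [Group N] [Fintype N] (θ : FDRep ℂ N) (hθ : Simple θ) (z : N) :
    ∑ x, θ.character x * θ.character (x⁻¹ * z) =
      (Nat.card N : ℂ) / Module.finrank ℂ θ * θ.character z := by
  have hirr := irr_of_simple θ hθ
  have := nontrivial_of_simple θ hθ
  let M : θ →ₗ[ℂ] θ := ∑ x, θ.character x • θ.ρ x⁻¹
  have hcomm : ∀ y, M * θ.ρ y = θ.ρ y * M := by
    intro y
    simp only [M, Finset.sum_mul, Finset.mul_sum]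
    rw [← Equiv.sum_comp (MulAut.conj y).toEquiv]
    refine Finset.sum_congr rfl (fun x _ => ?_)
    have h1 : θ.character ((MulAut.conj y).toEquiv x) = θ.character x := by
      simp
    rw [h1, smul_mul_assoc, mul_smul_comm, ← map_mul, ← map_mul]
    congr 2
    simp [mul_assoc]
  obtain ⟨μ, hμ⟩ := Module.End.exists_eigenvalue (K := ℂ) (V := θ) M
  have hM : ∀ v, M v = μ • v := by
    have htop := (hirr (Module.End.eigenspace M μ) (by
      intro y v hv
      rw [Module.End.mem_eigenspace_iff] at *
      have := congrArg (fun t => t v) (hcomm y)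
      simp only [Module.End.mul_apply] at this
      rw [this, hv, map_smul])).resolve_left hμ
    intro v
    rw [← Module.End.mem_eigenspace_iff, htop]
    trivial
  have htr : ∀ y, ∑ x, θ.character x * θ.character (x⁻¹ * y) = μ * θ.character y := by
    intro y
    have h1 : M * θ.ρ y = μ • θ.ρ y := by
      ext v
      exact hM _
    have h2 := congrArg (LinearMap.trace ℂ θ) h1
    simp only [M, Finset.sum_mul, map_sum, smul_mul_assoc, map_smul, smul_eq_mul] at h2
    rw [FDRep.character, ← h2]
    refine Finset.sum_congr rfl (fun x _ => ?_)
    rw [← map_mul]; rfl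
  have hf : (Module.finrank ℂ θ : ℂ) ≠ 0 := Nat.cast_ne_zero.2 Module.finrank_pos.ne'
  have hN : (Nat.card N : ℂ) ≠ 0 := Nat.cast_ne_zero.2 Nat.card_pos.ne'
  have hμ' : μ * Module.finrank ℂ θ = Nat.card N := by
    have h1 := htr 1
    rw [FDRep.char_one] at h1
    let _ : Invertible (Nat.card N : ℂ) := invertibleOfNonzero hN
    have h2 := FDRep.char_orthonormal θ θ
    rw [if_pos ⟨Iso.refl θ⟩, inv_mul_eq_iff_eq_mul₀ hN, mul_one] at h2
    rw [← h1, ← h2]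
    simp
  rw [htr, ← hμ', mul_div_cancel_right₀ _ hf]

theorem integral_ratio {N : Type} [Group N] [Fintype N] (θ : N → ℂ) (d : ℂ)
    (hInteg : ∀ x, IsIntegral ℤ (θ x)) (h1 : θ 1 ≠ 0)
    (hconv : ∀ z, ∑ x, θ x * θ (x⁻¹ * z) = d * θ z) : IsIntegral ℤ d := by
  let A := integralClosure ℤ ℂ
  let S : Submodule A ℂ := Submodule.span A (Set.range θ)
  have : IsIntegral A d := by
    refine isIntegral_of_smul_mem_submodule S ?_ ?_ d ?_
    · intro hb
      apply h1
      rw [← Submodule.mem_bot A, ← hb]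
      exact Submodule.subset_span ⟨1, rfl⟩
    · exact Submodule.fg_span (Set.finite_range θ)
    · intro n hn
      induction hn using Submodule.span_induction with
      | mem x hx =>
        obtain ⟨z, rfl⟩ := hx
        rw [smul_eq_mul, ← hconv z]
        refine Submodule.sum_mem _ (fun x _ => ?_)
        exact S.smul_mem (⟨θ x, hInteg x⟩ : A) (Submodule.subset_span ⟨x⁻¹ * z, rfl⟩)
      | zero => rw [smul_zero]; exact S.zero_mem
      | add x y _ _ hx hy => rw [smul_add]; exact S.add_mem hx hy
      | smul a x _ hx => rw [smul_comm]; exact S.smul_mem a hx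
  exact isIntegral_trans (A := A) d this



theorem rat_int {r : ℚ} (h : IsIntegral ℤ (r : ℂ)) : ∃ z : ℤ, (z : ℚ) = r := by
  have h' : IsIntegral ℤ (algebraMap ℚ ℂ r) := by simpa using h
  rw [isIntegral_algebraMap_iff (algebraMap ℚ ℂ).injective] at h'
  obtain ⟨z, hz⟩ := IsIntegrallyClosed.isIntegral_iff.1 h'
  exact ⟨z, by simpa using hz⟩

theorem eq_zero_of_div (p : ℕ) (hp : p.Prime) (t : ℂ) (ht : IsIntegral ℤ t)
    (h : ∀ k : ℕ, ∃ y : ℂ, IsIntegral ℤ y ∧ t = (p : ℂ) ^ k * y) : t = 0 := by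
  by_contra hne
  -- an integral cofactor with nonzero integer product
  obtain ⟨u, c, hu, hc, huc⟩ : ∃ (u : ℂ) (c : ℤ), IsIntegral ℤ u ∧ c ≠ 0 ∧ t * u = c := by
    let P := minpoly ℤ t
    refine ⟨-(Polynomial.aeval t P.divX), P.coeff 0, ?_, ?_, ?_⟩
    · apply IsIntegral.neg
      rw [Polynomial.aeval_eq_sum_range]
      exact IsIntegral.sum _ (fun i _ => (ht.pow i).smul _)
    · intro h0
      have hQ : IsIntegral ℚ t := ht.tower_top
      apply minpoly.coeff_zero_ne_zero hQ hne
      rw [minpoly.isIntegrallyClosed_eq_field_fractions' ℚ ht, Polynomial.coeff_map, h0, map_zero]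
    · have h1 : Polynomial.aeval t (P.divX * Polynomial.X + Polynomial.C (P.coeff 0)) = 0 := by
        rw [Polynomial.divX_mul_X_add]; exact minpoly.aeval ℤ t
      simp at h1
      linear_combination -h1
  have hdiv : ∀ k : ℕ, ((p : ℤ) ^ k) ∣ c := by
    intro k
    obtain ⟨y, hy, hty⟩ := h k
    have hpk : ((p : ℂ) ^ k) ≠ 0 := pow_ne_zero _ (Nat.cast_ne_zero.2 hp.ne_zero)
    have hpk' : ((p : ℚ) ^ k) ≠ 0 := pow_ne_zero _ (Nat.cast_ne_zero.2 hp.ne_zero)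
    have h1 : (((c : ℚ) / (p : ℚ) ^ k : ℚ) : ℂ) = y * u := by
      push_cast
      rw [div_eq_iff hpk, ← huc, hty]; ring
    obtain ⟨z, hz⟩ := rat_int (r := (c : ℚ) / (p : ℚ) ^ k) (by rw [h1]; exact hy.mul hu)
    refine ⟨z, ?_⟩
    rw [eq_div_iff hpk'] at hz
    have : ((z * (p : ℤ) ^ k : ℤ) : ℚ) = c := by push_cast; exact hz
    have := Int.cast_injective this
    rw [← this]; ring
  have h2 := Int.le_of_dvd (abs_pos.2 hc) ((dvd_abs _ _).2 (hdiv c.natAbs))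
  have h3 : c.natAbs < p ^ c.natAbs := Nat.lt_pow_self hp.one_lt
  have h4 : ((c.natAbs : ℕ) : ℤ) < (p : ℤ) ^ c.natAbs := by exact_mod_cast h3
  rw [Int.natCast_natAbs] at h4
  omega

theorem regular_pow {N : Type} [Group N] [Fintype N] (p : ℕ) (hp : p.Prime) (x : N) (s : ℕ)
    (hs : Nat.card N ≤ s) : ¬ p ∣ orderOf (x ^ p ^ s) := by
  intro h
  have ho := orderOf_pos x
  rw [orderOf_pow] at h
  obtain ⟨i, hi, hgi⟩ := (Nat.dvd_prime_pow hp).1 (Nat.gcd_dvd_right (orderOf x) (p ^ s))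
  rw [hgi] at h
  have h1 : p ^ (i + 1) ∣ orderOf x := by
    have h2 : p ^ i ∣ orderOf x := hgi ▸ Nat.gcd_dvd_left (orderOf x) (p ^ s)
    rw [pow_succ]
    exact (Nat.dvd_div_iff_mul_dvd h2).1 h
  rcases Nat.lt_or_ge i s with his | his
  · have h3 : p ^ (i + 1) ∣ p ^ i := by
      rw [← hgi]; exact Nat.dvd_gcd h1 (pow_dvd_pow _ his)
    have := (Nat.pow_dvd_pow_iff_le_right hp.one_lt).1 h3
    omega
  · have h3 : p ^ (i + 1) ≤ Nat.card N :=
      Nat.le_of_dvd Nat.card_pos (h1.trans (orderOf_dvd_natCard x))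
    have h4 : i + 1 < p ^ (i + 1) := Nat.lt_pow_self hp.one_lt
    omega

/-- Rotation of words. -/
def rot {N : Type} {m : ℕ} (c : Fin (m + 1)) (w : Fin (m + 1) → N) : Fin (m + 1) → N :=
  fun i => w (i + c)

/-- Partial products of periodic words. -/
def pp {N : Type} [Group N] {m : ℕ} (w : Fin (m + 1) → N) (k : ℕ) : N :=
  ((List.range k).map (fun i => w (Fin.ofNat (m + 1) i))).prod

theorem ofNat_add (m a b : ℕ) :
    Fin.ofNat (m + 1) (a + b) = Fin.ofNat (m + 1) b + Fin.ofNat (m + 1) a := by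
  apply Fin.ext
  simp [Fin.val_add, add_comm]

theorem ofNat_nsmul (m r : ℕ) : Fin.ofNat (m + 1) r = r • (1 : Fin (m + 1)) := by
  induction r with
  | zero => simp
  | succ r ih => rw [ofNat_add, ih, succ_nsmul']; rfl

theorem pp_add {N : Type} [Group N] {m : ℕ} (w : Fin (m + 1) → N) (a b : ℕ) :
    pp w (a + b) = pp w a * pp (rot (Fin.ofNat (m + 1) a) w) b := by
  unfold pp
  rw [List.range_add, List.map_append, List.prod_append, List.map_map]
  congr 3
  funext i
  simp only [Function.comp, rot, ofNat_add]

theorem rot_zero {N : Type} {m : ℕ} (w : Fin (m + 1) → N) : rot 0 w = w := by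
  funext i; simp [rot]

theorem pp_full {N : Type} [Group N] {m : ℕ} (w : Fin (m + 1) → N) :
    pp w (m + 1) = (List.ofFn w).prod := by
  unfold pp
  rw [List.ofFn_eq_map, ← List.map_coe_finRange_eq_range, List.map_map]
  congr 2
  funext i
  simp

theorem pp_rot {N : Type} [Group N] {m : ℕ} (w : Fin (m + 1) → N) (c : Fin (m + 1)) :
    IsConj (pp w (m + 1)) (pp (rot c w) (m + 1)) := by
  have h1 := pp_add w c (m + 1)
  have h2 := pp_add w (m + 1) c
  have h3 : Fin.ofNat (m + 1) (m + 1) = 0 := by apply Fin.ext; simp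
  have h4 : Fin.ofNat (m + 1) (c : ℕ) = c := by simp
  rw [h3, rot_zero, add_comm, h1, h4] at h2
  rw [isConj_comm, isConj_iff]
  exact ⟨pp w c, by rw [h2]; group⟩

theorem pp_pow {N : Type} [Group N] {m : ℕ} (w : Fin (m + 1) → N) (a b : ℕ)
    (h : rot (Fin.ofNat (m + 1) a) w = w) : pp w (a * b) = pp w a ^ b := by
  induction b with
  | zero => simp [pp]
  | succ b ih => rw [mul_add, mul_one, add_comm, pp_add, h, ih, pow_succ']

instance rotAction (N : Type) (m : ℕ) :
    MulAction (Multiplicative (Fin (m + 1))) (Fin (m + 1) → N) where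
  smul c w := rot c.toAdd w
  one_smul w := rot_zero w
  mul_smul a b w := by
    funext i
    change w (i + (a.toAdd + b.toAdd)) = w (i + a.toAdd + b.toAdd)
    rw [add_assoc]

theorem sum_orbits {C X : Type} [Group C] [Fintype X] [MulAction C X] (f : X → ℂ)
    (hf : ∀ (c : C) x, f (c • x) = f x) (hInteg : ∀ x, IsIntegral ℤ (f x)) (q : ℕ)
    (hq : ∀ x, f x ≠ 0 → q ∣ (MulAction.stabilizer C x).index) :
    ∃ y : ℂ, IsIntegral ℤ y ∧ ∑ x, f x = q * y := by
  classical
  have key : ∀ ω : MulAction.orbitRel.Quotient C X, ∃ y : ℂ, IsIntegral ℤ y ∧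
      ∑ x with (Quotient.mk'' x : MulAction.orbitRel.Quotient C X) = ω, f x = q * y := by
    intro ω
    induction ω using Quotient.inductionOn' with
    | h x₀ =>
    have hmem : ∀ x, (Quotient.mk'' x : MulAction.orbitRel.Quotient C X) = Quotient.mk'' x₀ ↔
        x ∈ MulAction.orbit C x₀ := by
      intro x
      rw [Quotient.eq'', MulAction.orbitRel_apply]
    have hs : ∑ x with (Quotient.mk'' x : MulAction.orbitRel.Quotient C X) = Quotient.mk'' x₀, f x
        = (MulAction.stabilizer C x₀).index * f x₀ := by
      rw [Finset.sum_congr rfl (g := fun _ => f x₀), Finset.sum_const, nsmul_eq_mul,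
        MulAction.index_stabilizer, Set.ncard_eq_toFinset_card']
      · congr 3
        ext x
        simp [hmem]
      · intro x hx
        obtain ⟨c, rfl⟩ := (hmem x).1 (Finset.mem_filter.1 hx).2
        exact hf c x₀
    rw [hs]
    by_cases h0 : f x₀ = 0
    · exact ⟨0, isIntegral_zero, by simp [h0]⟩
    · obtain ⟨r, hr⟩ := hq x₀ h0
      refine ⟨r * f x₀, (isIntegral_natCast r).mul (hInteg x₀), ?_⟩
      rw [hr]; push_cast; ring
  choose y hy hsum using key
  refine ⟨∑ ω, y ω, IsIntegral.sum _ (fun ω _ => hy ω), ?_⟩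
  rw [Finset.mul_sum, ← Finset.sum_fiberwise Finset.univ
    (fun x => (Quotient.mk'' x : MulAction.orbitRel.Quotient C X)) f]
  exact Finset.sum_congr rfl (fun ω _ => hsum ω)

theorem conv_pow {N : Type} [Group N] [Fintype N] (θ : N → ℂ) (d : ℂ)
    (hconv : ∀ z, ∑ x, θ x * θ (x⁻¹ * z) = d * θ z) (m : ℕ) : ∀ F : N → ℂ,
    ∑ w : Fin (m + 1) → N, (∏ i, θ (w i)) * F (List.ofFn w).prod = d ^ m * ∑ y, θ y * F y := by
  induction m with
  | zero =>
    intro F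
    rw [← (Equiv.funUnique (Fin 1) N).symm.sum_comp]
    simp
  | succ m ih =>
    intro F
    rw [← (Fin.consEquiv (fun _ : Fin (m + 1 + 1) => N)).sum_comp, Fintype.sum_prod_type]
    have : ∀ x : N, ∑ w : Fin (m + 1) → N, (∏ i, θ ((Fin.consEquiv (fun _ : Fin (m + 1 + 1) => N)) (x, w) i))
        * F (List.ofFn ((Fin.consEquiv (fun _ : Fin (m + 1 + 1) => N)) (x, w))).prod
        = θ x * (d ^ m * ∑ y, θ y * F (x * y)) := by
      intro x
      rw [← ih (fun y => F (x * y)), Finset.mul_sum]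
      refine Finset.sum_congr rfl (fun w _ => ?_)
      rw [Fin.prod_univ_succ, List.ofFn_succ, List.prod_cons]
      simp [Fin.consEquiv, mul_assoc]
    rw [Finset.sum_congr rfl (fun x _ => this x)]
    have h2 : ∀ x : N, ∑ y, θ y * F (x * y) = ∑ z, θ (x⁻¹ * z) * F z := by
      intro x
      rw [← Equiv.sum_comp (Equiv.mulLeft x) (fun z => θ (x⁻¹ * z) * F z)]
      simp
    simp_rw [h2, Finset.mul_sum]
    rw [Finset.sum_comm]
    refine Finset.sum_congr rfl (fun z _ => ?_)
    rw [pow_succ, mul_assoc (d ^ m), ← mul_assoc d, ← hconv z, Finset.sum_mul, Finset.mul_sum]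
    exact Finset.sum_congr rfl (fun x _ => by ring)

theorem vanish {N : Type} [Group N] [Fintype N] (p : ℕ) (hp : p.Prime) (θ : N → ℂ) (d : ℕ)
    (hd : ¬ p ∣ d) (hInteg : ∀ x, IsIntegral ℤ (θ x)) (hcl : ∀ x y, IsConj x y → θ x = θ y)
    (hconv : ∀ z, ∑ x, θ x * θ (x⁻¹ * z) = d * θ z) (g : N) (hg : p ∣ orderOf g) : θ g = 0 := by
  classical
  let K : Finset N := Finset.univ.filter (fun y => IsConj g y)
  have hK : (K.card : ℂ) ≠ 0 := by
    rw [Nat.cast_ne_zero]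
    exact Finset.card_ne_zero.2 ⟨g, Finset.mem_filter.2 ⟨Finset.mem_univ g, IsConj.refl g⟩⟩
  suffices h : (K.card : ℂ) * θ g = 0 from (mul_eq_zero.1 h).resolve_left hK
  have hti : IsIntegral ℤ ((K.card : ℂ) * θ g) := (isIntegral_natCast _).mul (hInteg g)
  apply eq_zero_of_div p hp _ hti
  intro k
  let n := k + Nat.card N
  obtain ⟨m, hm⟩ : ∃ m, p ^ n = m + 1 :=
    ⟨p ^ n - 1, by have := Nat.pow_pos (n := n) hp.pos; omega⟩
  let F : N → ℂ := fun y => if IsConj g y then 1 else 0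
  have hF : ∀ x y, IsConj x y → F x = F y := by
    intro x y hxy
    simp only [F]
    have : IsConj g x ↔ IsConj g y := ⟨fun h => h.trans hxy, fun h => h.trans hxy.symm⟩
    simp only [this]
  have h1 := conv_pow θ d hconv m F
  have h2 : ∑ y, θ y * F y = K.card * θ g := by
    simp only [F, mul_ite, mul_one, mul_zero]
    rw [← Finset.sum_filter, Finset.sum_congr rfl (g := fun _ => θ g), Finset.sum_const,
      nsmul_eq_mul]
    intro y hy
    exact (hcl _ _ (Finset.mem_filter.1 hy).2).symm
  rw [h2] at h1
  obtain ⟨y, hy, hsum⟩ := sum_orbits (C := Multiplicative (Fin (m + 1)))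
    (fun w : Fin (m + 1) → N => (∏ i, θ (w i)) * F (List.ofFn w).prod) (by
      intro c w
      change (∏ i, θ (w (i + c.toAdd))) * F (List.ofFn (rot c.toAdd w)).prod = _
      rw [← pp_full, ← pp_full, hF _ _ (pp_rot w c.toAdd)]
      congr 1
      exact Equiv.prod_comp (Equiv.addRight c.toAdd) (fun i => θ (w i))) (by
      intro w
      apply IsIntegral.mul
      · exact IsIntegral.prod _ (fun i _ => hInteg _)
      · simp only [F]
        split_ifs
        · exact isIntegral_one
        · exact isIntegral_zero) (p ^ k) (by
      intro w hw
      have hFw : IsConj g (pp w (m + 1)) := by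
        by_contra hc
        apply hw
        rw [pp_full] at hc
        simp only [F, if_neg hc, mul_zero]
      have hidx := (MulAction.stabilizer (Multiplicative (Fin (m + 1))) w).index_dvd_card
      have hcard : Nat.card (Multiplicative (Fin (m + 1))) = p ^ n := by
        rw [hm]; simp
      rw [hcard] at hidx
      obtain ⟨j, hj, hidx⟩ := (Nat.dvd_prime_pow hp).1 hidx
      rw [hidx]
      apply pow_dvd_pow
      by_contra hjk
      have hst := Subgroup.pow_index_mem (MulAction.stabilizer (Multiplicative (Fin (m + 1))) w)
        (Multiplicative.ofAdd 1)
      rw [hidx, MulAction.mem_stabilizer_iff, ← ofAdd_nsmul] at hst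
      have hst' : rot (Fin.ofNat (m + 1) (p ^ j)) w = w := by
        have h5 : Fin.ofNat (m + 1) (p ^ j) = (p ^ j) • (1 : Fin (m + 1)) := by
          exact ofNat_nsmul m (p ^ j)
        rw [h5]; exact hst
      have hpw := pp_pow w (p ^ j) (p ^ (n - j)) hst'
      rw [← pow_add, Nat.add_sub_cancel' hj, hm] at hpw
      rw [hpw] at hFw
      apply regular_pow p hp (pp w (p ^ j)) (n - j) (by omega)
      obtain ⟨c, hc⟩ := isConj_iff.1 hFw
      rw [← hc]
      have : orderOf (c * g * c⁻¹) = orderOf g := by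
        have := orderOf_injective (MulAut.conj c).toMonoidHom (MulAut.conj c).injective g
        simpa using this
      rwa [this])
  rw [hsum] at h1
  -- Bezout
  have hcop : IsCoprime ((p : ℤ) ^ k) ((d : ℤ) ^ m) := by
    apply IsCoprime.pow
    exact Nat.isCoprime_iff_coprime.2 ((Nat.Prime.coprime_iff_not_dvd hp).2 hd)
  obtain ⟨a, b, hab⟩ := hcop
  have hab' : (a : ℂ) * (p : ℂ) ^ k + b * (d : ℂ) ^ m = 1 := by exact_mod_cast hab
  refine ⟨a * (K.card * θ g) + b * y, ?_, ?_⟩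
  · exact ((isIntegral_intCast a).mul hti).add ((isIntegral_intCast b).mul hy)
  · push_cast at h1
    linear_combination (-(K.card * θ g)) * hab' - b * h1

end DZ

/-- If a normal subgroup `N` of `G` has an irreducible character of `p`-defect zero,
then every element of `N` of order divisible by `p` is a vanishing element of `G`. -/
theorem stmt8 (G : Type) [Group G] [Fintype G] (N : Subgroup G) [N.Normal]
    (p : ℕ) (hp : p.Prime)
    (θ : FDRep ℂ N) (hθ : Simple θ)
    (hdefect : ¬ p ∣ Nat.card N / Module.finrank ℂ θ)
    (g : G) (hg : g ∈ N) (hord : p ∣ orderOf g) :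
    IsVanishing g := by
  have := Fintype.ofFinite N
  have hInteg : ∀ x, IsIntegral ℤ (θ.character x) := fun x => DZ.char_integral θ.ρ x
  have := DZ.nontrivial_of_simple θ hθ
  have hpos : 0 < Module.finrank ℂ θ := Module.finrank_pos
  have hf : (Module.finrank ℂ θ : ℂ) ≠ 0 := Nat.cast_ne_zero.2 hpos.ne'
  have hf' : (Module.finrank ℂ θ : ℚ) ≠ 0 := Nat.cast_ne_zero.2 hpos.ne'
  have hconv := DZ.char_conv θ hθ
  have hd := DZ.integral_ratio θ.character _ hInteg (by rw [FDRep.char_one]; exact hf) hconv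
  obtain ⟨z, hz⟩ := DZ.rat_int (r := (Nat.card N : ℚ) / Module.finrank ℂ θ) (by
    push_cast; exact hd)
  have hdvd : Module.finrank ℂ θ ∣ Nat.card N := by
    rw [eq_div_iff hf'] at hz
    have h1 : z * (Module.finrank ℂ θ : ℤ) = (Nat.card N : ℤ) := by exact_mod_cast hz
    exact Int.natCast_dvd_natCast.1 ⟨z, by rw [← h1]; ring⟩
  have hcast : ((Nat.card N / Module.finrank ℂ θ : ℕ) : ℂ)
      = (Nat.card N : ℂ) / Module.finrank ℂ θ := Nat.cast_div hdvd hf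
  have hv : ∀ y : N, p ∣ orderOf y → θ.character y = 0 := by
    intro y hy
    refine DZ.vanish p hp θ.character _ hdefect hInteg ?_ ?_ y hy
    · intro a b hab
      obtain ⟨c, rfl⟩ := isConj_iff.1 hab
      rw [FDRep.char_conj]
    · intro w
      rw [hcast]; exact hconv w
  refine DZ.clifford N θ.ρ (DZ.irr_of_simple θ hθ) ⟨g, hg⟩ ?_
  intro x
  apply hv
  have h1 : orderOf (MulAut.conjNormal x (⟨g, hg⟩ : N)) = orderOf (⟨g, hg⟩ : N) :=
    orderOf_injective (MulAut.conjNormal x : N ≃* N).toMonoidHom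
      (MulAut.conjNormal x : N ≃* N).injective _
  rw [h1, Subgroup.orderOf_mk]
  exact hord
end

section
/- Let G be a finite non-abelian nilpotent group satisfying: gcd(ord(x), ord(y)) ≤ 2 for any two vanishing elements x, y of G in distinct conjugacy classes. Then G has an abelian normal 2-complement, i.e., G = P × H where P is the Sylow 2-subgroup and H is abelian of odd order. -/
open CategoryTheory

open scoped MonoidAlgebra

lemma exists_scalar_of_simple {G : Type} [Group G] [Fintype G] (N : Submodule ℂ[G] ℂ[G])
    [IsSimpleModule ℂ[G] N] (f : N →ₗ[ℂ[G]] N) : ∃ c : ℂ, ∀ v, f v = c • v := by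
  have : Module.Finite ℂ ℂ[G] := Module.Finite.of_basis (MonoidAlgebra.basis G ℂ)
  have : Module.Finite ℂ N :=
    Module.Finite.of_injective (N.subtype.restrictScalars ℂ) N.injective_subtype
  obtain ⟨c, hc⟩ := (IsSimpleModule.algebraMap_end_bijective_of_isAlgClosed ℂ
    (A := ℂ[G]) (V := N)).2 f
  exact ⟨c, fun v => by rw [← hc]; rfl⟩

lemma simple_of_scalar {G : Type} [Group G] [Fintype G] {W : Type} [AddCommGroup W] [Module ℂ W]
    [Module.Finite ℂ W] (r : Representation ℂ G W) (v : W) (hv : v ≠ 0)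
    (scal : ∀ f : W →ₗ[ℂ] W, (∀ a w, f (r a w) = r a (f w)) → ∃ c : ℂ, ∀ w, f w = c • w) :
    Simple (FDRep.of r) := by
  rw [FDRep.simple_iff_end_is_rank_one]
  have hid : (𝟙 (FDRep.of r)) ≠ 0 := by
    intro h
    have h3 : (𝟙 (FDRep.of r) : FDRep.of r ⟶ FDRep.of r).hom.hom.hom v
      = (0 : FDRep.of r ⟶ FDRep.of r).hom.hom.hom v := by rw [h]
    exact hv h3
  rw [finrank_eq_one_iff_of_nonzero' _ hid]
  intro f
  obtain ⟨c, hcc⟩ := scal f.hom.hom.hom (by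
    intro a w
    exact ConcreteCategory.congr_hom ((forget (FGModuleCat ℂ)).congr_map (f.comm a)) w)
  refine ⟨c, ?_⟩
  ext w
  exact (hcc w).symm

lemma vanishing_of_conj {G : Type} [Group G] [Fintype G] (x z g : G) (hz : z ≠ 1)
    (hc : ∀ a : G, a * z = z * a) (hx : g * x * g⁻¹ = x * z) : IsVanishing x := by
  have : Module.Finite ℂ ℂ[G] := Module.Finite.of_basis (MonoidAlgebra.basis G ℂ)
  have key : ∃ N : Submodule ℂ[G] ℂ[G], IsSimpleModule ℂ[G] N ∧
      ∃ v : N, MonoidAlgebra.of ℂ G z • v ≠ v := by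
    by_contra! hcon
    let L : ℂ[G] →ₗ[ℂ] ℂ[G] := LinearMap.mulLeft ℂ (MonoidAlgebra.of ℂ G z)
    have hcomm : ∀ a : ℂ[G], Commute a (MonoidAlgebra.of ℂ G z) := by
      intro a
      induction a using MonoidAlgebra.induction_on with
      | of g => simp [Commute, SemiconjBy, MonoidAlgebra.single_mul_single, hc]
      | add a b ha hb => exact ha.add_left hb
      | smul r a ha => exact ha.smul_left r
    let K : Submodule ℂ[G] ℂ[G] :=
      { carrier := {a | MonoidAlgebra.of ℂ G z * a = a}
        add_mem' := by
          intro a b ha hb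
          simp only [Set.mem_ofPred_eq] at *
          rw [mul_add, ha, hb]
        zero_mem' := by simp
        smul_mem' := by
          intro c a ha
          simp only [Set.mem_ofPred_eq, smul_eq_mul] at *
          rw [← mul_assoc, ← (hcomm c).eq, mul_assoc, ha] }
    have hK : K = ⊤ := by
      rw [eq_top_iff, ← IsSemisimpleModule.sSup_simples_eq_top ℂ[G] ℂ[G]]
      apply sSup_le
      intro N hN a ha
      exact congrArg Subtype.val (hcon N hN ⟨a, ha⟩)
    have h1 : (1 : ℂ[G]) ∈ K := hK ▸ Submodule.mem_top
    have h2 : MonoidAlgebra.of ℂ G z * 1 = 1 := h1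
    rw [mul_one, ← map_one (MonoidAlgebra.of ℂ G)] at h2
    exact hz (MonoidAlgebra.of_injective h2)
  obtain ⟨N, hN, v, hv⟩ := key
  have : Module.Finite ℂ N :=
    Module.Finite.of_injective (N.subtype.restrictScalars ℂ) N.injective_subtype
  let r : Representation ℂ G N := Representation.ofModule' N
  have hr : ∀ (a : G) (w : N), r a w = MonoidAlgebra.single a (1 : ℂ) • w := by
    intro a w
    rfl
  have scal : ∀ f : N →ₗ[ℂ] N, (∀ a w, f (r a w) = r a (f w)) → ∃ c : ℂ, ∀ w, f w = c • w := by
    intro f hf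
    exact exists_scalar_of_simple N (MonoidAlgebra.equivariantOfLinearOfComm f hf)
  refine ⟨FDRep.of r, ?_, ?_⟩
  · refine simple_of_scalar r v ?_ scal
    intro h4
    apply hv
    rw [h4, smul_zero]
  · obtain ⟨c, hcc⟩ := scal (r z) (by
      intro a w
      rw [← Module.End.mul_apply, ← Module.End.mul_apply, ← map_mul, ← map_mul, hc])
    have hc1 : c ≠ 1 := by
      rintro rfl
      apply hv
      have := hcc v
      rw [one_smul] at this
      exact this
    have hrz : r z = c • 1 := by
      ext1 w
      exact hcc w
    have h5 : (FDRep.of r).character x = c * (FDRep.of r).character x := by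
      conv_lhs => rw [← FDRep.char_conj _ x g, hx]
      change LinearMap.trace ℂ N (r (x * z)) = c * LinearMap.trace ℂ N (r x)
      rw [map_mul, hrz, mul_smul_comm, mul_one, map_smul, smul_eq_mul]
    have h6 : (1 - c) * (FDRep.of r).character x = 0 := by linear_combination h5
    rcases mul_eq_zero.1 h6 with h | h
    · exact absurd (sub_eq_zero.1 h).symm hc1
    · exact h

lemma exists_hall (G : Type) [Group G] [Fintype G] [Group.IsNilpotent G] :
    ∃ H : Subgroup G, H.Normal ∧ Odd (Nat.card H) ∧ (∃ k : ℕ, H.index = 2 ^ k) ∧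
      (∀ g : G, ∃ h ∈ H, ∃ p : G, g = h * p ∧ ∀ a ∈ H, Commute a p) := by
  have : Fact (Nat.Prime 2) := ⟨Nat.prime_two⟩
  by_cases h2 : 2 ∣ Nat.card G
  swap
  · refine ⟨⊤, inferInstance, ?_, ⟨0, by simp⟩, ?_⟩
    · rw [Subgroup.card_top]
      exact Nat.not_even_iff_odd.1 (fun h => h2 h.two_dvd)
    · exact fun g => ⟨g, trivial, 1, by simp, fun a _ => Commute.one_right a⟩
  let e := Sylow.directProductOfNormal (G := G) (fun P => inferInstance)
  let i : (Nat.card G).primeFactors := ⟨2, Nat.mem_primeFactors.2 ⟨Nat.prime_two, h2, Nat.card_pos.ne'⟩⟩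
  let P : Sylow 2 G := default
  let φ : G →* P :=
    ((Pi.evalMonoidHom (fun Q : Sylow (i : ℕ) G => Q) P).comp
      (Pi.evalMonoidHom (fun p : (Nat.card G).primeFactors => ∀ Q : Sylow p G, Q) i)).comp
      e.symm.toMonoidHom
  have hφ : Function.Surjective φ := by
    classical
    intro y
    refine ⟨e (Pi.mulSingle i (Pi.mulSingle P y)), ?_⟩
    simp [φ]
  have hidx : φ.ker.index = Nat.card P := by
    rw [Subgroup.index_ker, MonoidHom.range_eq_top.2 hφ, Subgroup.card_top]
  have hP := P.card_eq_multiplicity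
  have hcard : Nat.card φ.ker * Nat.card P = Nat.card G := by
    rw [← hidx, Subgroup.card_mul_index]
  have hodd : Odd (Nat.card φ.ker) := by
    have hne : Nat.card G ≠ 0 := Nat.card_pos.ne'
    have h1 : Nat.card φ.ker = ordCompl[2] (Nat.card G) := by
      rw [← hP]
      exact (Nat.div_eq_of_eq_mul_left Nat.card_pos hcard.symm).symm
    rw [h1]
    have := Nat.not_dvd_ordCompl Nat.prime_two hne
    exact Nat.not_even_iff_odd.1 (fun h => this h.two_dvd)
  have hcop : Nat.Coprime (Nat.card φ.ker) (Nat.card P) := by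
    rw [hP]
    exact (Nat.coprime_two_right.2 hodd).pow_right _
  have hcompl : Subgroup.IsComplement' φ.ker (P : Subgroup G) :=
    Subgroup.isComplement'_of_coprime hcard hcop
  refine ⟨φ.ker, inferInstance, hodd, ⟨_, hidx.trans hP⟩, ?_⟩
  intro g
  obtain ⟨⟨h, p⟩, hp⟩ := hcompl.2 g
  refine ⟨h, h.2, p, hp.symm, ?_⟩
  intro a ha
  exact Subgroup.commute_of_normal_of_disjoint _ _ inferInstance inferInstance
    hcompl.disjoint a p ha p.2

lemma exists_second_center (H : Type) [Group H] [Group.IsNilpotent H]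
    (hn : ¬ ∀ a b : H, a * b = b * a) :
    ∃ x g z : H, z ≠ 1 ∧ (∀ a, a * z = z * a) ∧ g * x * g⁻¹ = x * z := by
  have hne : Subgroup.center H ≠ ⊤ := by
    intro h
    apply hn
    intro a b
    have hb : b ∈ Subgroup.center H := h ▸ Subgroup.mem_top b
    exact Subgroup.mem_center_iff.1 hb a
  have : Nontrivial (H ⧸ Subgroup.center H) := QuotientGroup.nontrivial_iff.2 hne
  have hb := Group.IsNilpotent.center_ne_bot (H ⧸ Subgroup.center H)
  obtain ⟨q, hq, hq1⟩ := Subgroup.ne_bot_iff_exists_ne_one.1 hb |>.elim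
    (fun q hq => (⟨q.1, q.2, fun h => hq (Subtype.ext h)⟩ :
      ∃ q : H ⧸ Subgroup.center H, q ∈ Subgroup.center _ ∧ q ≠ 1))
  obtain ⟨x, rfl⟩ := QuotientGroup.mk_surjective q
  have hx : x ∉ Subgroup.center H := fun h => hq1 ((QuotientGroup.eq_one_iff x).2 h)
  rw [Subgroup.mem_center_iff] at hx
  push Not at hx
  obtain ⟨g, hg⟩ := hx
  refine ⟨x, g, x⁻¹ * (g * x * g⁻¹), ?_, ?_, by group⟩
  · intro h
    apply hg
    have := inv_mul_eq_one.1 h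
    rw [eq_mul_inv_iff_mul_eq] at this
    exact this.symm
  · have : x⁻¹ * (g * x * g⁻¹) ∈ Subgroup.center H := by
      rw [← QuotientGroup.eq_one_iff]
      have := Subgroup.mem_center_iff.1 hq (g : H ⧸ Subgroup.center H)
      change (x : H ⧸ Subgroup.center H)⁻¹ * (g * x * (g : H ⧸ Subgroup.center H)⁻¹) = 1
      rw [this]
      group
    exact Subgroup.mem_center_iff.1 this

/-- A finite non-abelian nilpotent group satisfying property (⋆⋆) has an abelian normal
2-complement. -/
theorem stmt16 (G : Type) [Group G] [Fintype G] [Group.IsNilpotent G]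
    (hnonab : ¬ ∀ a b : G, a * b = b * a)
    (hG : ∀ x y : G, IsVanishing x → IsVanishing y → ¬ IsConj x y →
      Nat.gcd (orderOf x) (orderOf y) ≤ 2) :
    ∃ H : Subgroup G, H.Normal ∧ Odd (Nat.card H) ∧ (∃ k : ℕ, H.index = 2 ^ k) ∧
      (∀ a ∈ H, ∀ b ∈ H, a * b = b * a) := by
  obtain ⟨H, hHn, hodd, hidx, hdec⟩ := exists_hall G
  refine ⟨H, hHn, hodd, hidx, ?_⟩
  by_contra hab
  have hab' : ¬ ∀ a b : H, a * b = b * a := by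
    intro h
    exact hab fun a ha b hb => congrArg Subtype.val (h ⟨a, ha⟩ ⟨b, hb⟩)
  obtain ⟨⟨x, hx⟩, ⟨g, hg⟩, ⟨z, hz⟩, hz1, hzc, hxz⟩ := exists_second_center H hab'
  have hz1' : z ≠ 1 := fun h => hz1 (Subtype.ext h)
  have hxz' : g * x * g⁻¹ = x * z := congrArg Subtype.val hxz
  have hzc' : ∀ a : G, a * z = z * a := by
    intro a
    obtain ⟨h, hh, p, rfl, hp⟩ := hdec a
    have h1 : h * z = z * h := congrArg Subtype.val (hzc ⟨h, hh⟩)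
    have h2 : Commute h z := h1
    exact (Commute.mul_left h2 (hp z hz).symm).eq
  have hoddo : ∀ a ∈ H, Odd (orderOf a) := by
    intro a ha
    exact hodd.of_dvd_nat (Subgroup.orderOf_dvd_natCard H ha)
  have hsq : ∀ a ∈ H, ∀ b : G, Commute (a ^ 2) b → Commute a b := by
    intro a ha b hb
    obtain ⟨m, hm⟩ := hoddo a ha
    have : a = (a ^ 2) ^ (m + 1) := by
      rw [← pow_mul, show 2 * (m + 1) = orderOf a + 1 by omega, pow_succ, pow_orderOf_eq_one,
        one_mul]
    rw [this]
    exact hb.pow_left _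
  have hx1 : x ≠ 1 := by
    rintro rfl
    apply hz1'
    simpa using hxz'.symm
  have v1 : IsVanishing x := vanishing_of_conj x z g hz1' hzc' hxz'
  have v2 : IsVanishing x⁻¹ := by
    refine vanishing_of_conj x⁻¹ z⁻¹ g (inv_ne_one.2 hz1') (fun a => ?_) ?_
    · exact (Commute.inv_right (hzc' a : Commute a z)).eq
    · have := congrArg (·⁻¹) hxz'
      simp only [hzc' x, mul_inv_rev, inv_inv] at this
      rw [← this, mul_assoc]
  have hnc : ¬ IsConj x x⁻¹ := by
    intro h
    obtain ⟨c, hc⟩ := isConj_iff.1 h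
    obtain ⟨k, hk, p, rfl, hp⟩ := hdec c
    have e1 : k * x * k⁻¹ = x⁻¹ := by
      rw [← hc]
      have := (hp x hx).eq
      calc k * x * k⁻¹ = k * (x * p) * p⁻¹ * k⁻¹ := by group
        _ = _ := by rw [this]; group
    have e2 : Commute (k ^ 2) x := by
      have e3 : k * (k * x * k⁻¹) * k⁻¹ = x := by
        rw [e1]
        calc k * x⁻¹ * k⁻¹ = (k * x * k⁻¹)⁻¹ := by group
          _ = x := by rw [e1, inv_inv]
      change k ^ 2 * x = x * k ^ 2
      calc k ^ 2 * x = k * (k * x * k⁻¹) * k⁻¹ * k ^ 2 := by simp [pow_two, mul_assoc]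
        _ = _ := by rw [e3]
    have e4 := (hsq k hk x e2).eq
    rw [e4, mul_inv_cancel_right] at e1
    have e5 : x ^ 2 = 1 := by
      rw [pow_two]
      nth_rewrite 1 [e1]
      simp
    have e6 := orderOf_dvd_of_pow_eq_one e5
    have e7 := hoddo x hx
    rcases (Nat.dvd_prime Nat.prime_two).1 e6 with h | h
    · exact hx1 (orderOf_eq_one_iff.1 h)
    · rw [h] at e7
      exact absurd e7 (by decide)
  have hle := hG x x⁻¹ v1 v2 hnc
  rw [orderOf_inv, Nat.gcd_self] at hle
  have e7 := hoddo x hx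
  have e8 : orderOf x ≠ 1 := fun h => hx1 (orderOf_eq_one_iff.1 h)
  obtain ⟨m, hm⟩ := e7
  omega
end
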